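/- Let 1 ≤ p < n, 0 ≤ a < n − p, and an/(n−p) ≤ b ≤ a + p. For a compact set K ⊂ ℝⁿ let μ_b(K) = ∫_K |x|^{−b} dx and cap_{p,a}(K) = inf{ ∫_{ℝⁿ} |∇v(x)|^p |x|^{−a} dx : v ∈ C_0^∞(ℝⁿ), v ≥ 1 on K }. Then the isocapacitary inequality ( μ_b(K) )^{(n−p−a)/(n−b)} ≤ ( (p−1)/(n−p−a) )^{p−1} · |S^{n−1}|^{(b−p−a)/(n−b)} · (n−b)^{−(n−p−a)/(n−b)} · cap_{p,a}(K) holds, where |S^{n−1}| = 2π^{n/2}/Γ(n/2) is the surface measure of the unit sphere in ℝⁿ. The constant factor is sharp, with equality attained for any closed ball centered at the origin. -/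

import Mathlib

open MeasureTheory
open scoped Real

noncomputable section

/-- The `(p,a)`-capacity of a set `K` in `ℝⁿ`:
`cap_{p,a}(K) = inf { ∫_{ℝⁿ} |∇v|^p |x|^{−a} dx : v ∈ C_0^∞(ℝⁿ), v ≥ 1 on K }`. -/
def capPA {n : ℕ} (p a : ℝ) (K : Set (EuclideanSpace ℝ (Fin n))) : ℝ :=
  sInf { r : ℝ | ∃ v : EuclideanSpace ℝ (Fin n) → ℝ, ContDiff ℝ (⊤ : ℕ∞) v ∧
    HasCompactSupport v ∧ (∀ x ∈ K, 1 ≤ v x) ∧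
    r = ∫ x : EuclideanSpace ℝ (Fin n), ‖fderiv ℝ v x‖ ^ p * ‖x‖ ^ (-a) }

section

open Set Filter Topology
open scoped ENNReal NNReal Pointwise

theorem volume_add_le_of_add_mem {A B C : Set ℝ} (hA : MeasurableSet A) (hB : MeasurableSet B)
    (hA' : A.Nonempty) (hB' : B.Nonempty)
    (h : ∀ x ∈ A, ∀ y ∈ B, x + y ∈ C) : volume A + volume B ≤ volume C := by
  have key : ∀ K ⊆ A, IsCompact K → ∀ L ⊆ B, IsCompact L → K.Nonempty → L.Nonempty →
      volume K + volume L ≤ volume C := by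
    intro K hKA hK L hLB hL hKn hLn
    obtain ⟨a, haK, ha⟩ := hK.exists_isGreatest hKn
    obtain ⟨b, hbL, hb⟩ := hL.exists_isLeast hLn
    have h1 : volume K = volume ((fun x => x + b) '' K) := by
      rw [Set.image_add_right, measure_preimage_add_right]
    have h2 : volume L = volume ((fun x => a + x) '' L) := by
      rw [Set.image_add_left, measure_preimage_add]
    have hd : volume (((fun x => x + b) '' K) ∩ ((fun x => a + x) '' L)) = 0 := by
      refine measure_mono_null (t := {a + b}) ?_ (by simp)
      rintro _ ⟨⟨x, hx, rfl⟩, ⟨y, hy, hxy⟩⟩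
      have := ha hx
      have := hb hy
      simp only [mem_singleton_iff] at *
      linarith
    have hm : MeasurableSet ((fun x => a + x) '' L) :=
      (hL.image (by fun_prop)).measurableSet
    have := measure_union_add_inter (μ := volume) ((fun x => x + b) '' K) hm
    rw [hd, add_zero] at this
    rw [h1, h2, ← this]
    refine measure_mono (union_subset ?_ ?_)
    · rintro _ ⟨x, hx, rfl⟩
      exact h x (hKA hx) b (hLB hbL)
    · rintro _ ⟨x, hx, rfl⟩
      exact h a (hKA haK) x (hLB hx)
  obtain ⟨a₀, ha₀⟩ := hA'
  obtain ⟨b₀, hb₀⟩ := hB'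
  refine le_of_forall_lt fun r hr => ?_
  have hA2 := hA.measure_eq_iSup_isCompact volume
  have hB2 := hB.measure_eq_iSup_isCompact volume
  simp only [iSup_and'] at hA2 hB2
  rw [hA2, hB2] at hr
  refine hr.trans_le (ENNReal.biSup_add_biSup_le' ⟨∅, by simp⟩ ⟨∅, by simp⟩ ?_)
  rintro K ⟨hKA, hK⟩ L ⟨hLB, hL⟩
  refine le_trans (add_le_add (measure_mono (subset_insert a₀ K))
    (measure_mono (subset_insert b₀ L)))
    (key _ (insert_subset ha₀ hKA) (hK.insert _) _ (insert_subset hb₀ hLB) (hL.insert _)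
      (insert_nonempty _ _) (insert_nonempty _ _))

theorem lintegral_eq_lintegral_volume_lt {f : ℝ → ℝ≥0∞} (hf : Measurable f) (h1 : ∀ x, f x ≤ 1) :
    ∫⁻ x, f x = ∫⁻ t in Ioi (0 : ℝ), volume {x | ENNReal.ofReal t < f x} := by
  have hfin : ∀ x, f x ≠ ∞ := fun x => ((h1 x).trans_lt ENNReal.one_lt_top).ne
  have := lintegral_eq_lintegral_meas_lt (f := fun x => (f x).toReal) volume
    (ae_of_all _ fun x => ENNReal.toReal_nonneg) hf.ennreal_toReal.aemeasurable
  simp only [ENNReal.ofReal_toReal (hfin _)] at this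
  rw [this]
  refine setLIntegral_congr_fun measurableSet_Ioi fun t ht => ?_
  simp only [ENNReal.ofReal_lt_iff_lt_toReal (le_of_lt ht) (hfin _)]

theorem prekopa_leindler_of_iSup_eq_one {f g h : ℝ → ℝ≥0∞} (hf : Measurable f)
    (hg : Measurable g) (hh : Measurable h) {α β : ℝ} (hα : 0 < α) (hβ : 0 < β) (hαβ : α + β = 1)
    (hf1 : ⨆ x, f x = 1) (hg1 : ⨆ x, g x = 1)
    (H : ∀ x y, f x ^ α * g y ^ β ≤ h (α * x + β * y)) :
    ENNReal.ofReal α * (∫⁻ x, f x) + ENNReal.ofReal β * (∫⁻ x, g x) ≤ ∫⁻ x, h x := by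
  have hfle : ∀ x, f x ≤ 1 := fun x => hf1 ▸ le_iSup f x
  have hgle : ∀ x, g x ≤ 1 := fun x => hg1 ▸ le_iSup g x
  have hmono : ∫⁻ x, min (h x) 1 ≤ ∫⁻ x, h x := lintegral_mono fun x => min_le_left _ _
  refine le_trans ?_ hmono
  rw [lintegral_eq_lintegral_volume_lt hf hfle, lintegral_eq_lintegral_volume_lt hg hgle,
    lintegral_eq_lintegral_volume_lt (hh.min measurable_const) (fun x => min_le_right _ _)]
  have mf : Measurable fun t : ℝ => volume {x | ENNReal.ofReal t < f x} :=
    Antitone.measurable fun s t hst => measure_mono fun x hx =>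
      (ENNReal.ofReal_le_ofReal hst).trans_lt hx
  rw [← lintegral_const_mul' _ _ ENNReal.ofReal_ne_top,
    ← lintegral_const_mul' _ _ ENNReal.ofReal_ne_top, ← lintegral_add_left (by fun_prop)]
  refine setLIntegral_mono' measurableSet_Ioi fun t ht => ?_
  rcases lt_or_ge t 1 with ht1 | ht1
  · have ht' : ENNReal.ofReal t < 1 := by simpa using ht1
    have hfn : {x | ENNReal.ofReal t < f x}.Nonempty := by
      rw [← hf1] at ht'
      exact lt_iSup_iff.1 ht'
    have hgn : {x | ENNReal.ofReal t < g x}.Nonempty := by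
      rw [← hg1] at ht'
      exact lt_iSup_iff.1 ht'
    have e1 := Measure.addHaar_smul (volume : Measure ℝ) α {x | ENNReal.ofReal t < f x}
    have e2 := Measure.addHaar_smul (volume : Measure ℝ) β {x | ENNReal.ofReal t < g x}
    simp only [Module.finrank_self, pow_one, abs_of_pos hα, abs_of_pos hβ] at e1 e2
    rw [← e1, ← e2]
    refine volume_add_le_of_add_mem ((measurableSet_lt measurable_const hf).const_smul₀ α)
      ((measurableSet_lt measurable_const hg).const_smul₀ β)
      hfn.smul_set hgn.smul_set ?_
    rintro _ ⟨x, hx, rfl⟩ _ ⟨y, hy, rfl⟩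
    refine lt_min (lt_of_lt_of_le ?_ (H x y)) ht'
    have ht0 : ENNReal.ofReal t ≠ 0 := by simpa using ht
    calc ENNReal.ofReal t = ENNReal.ofReal t ^ α * ENNReal.ofReal t ^ β := by
          rw [← ENNReal.rpow_add _ _ ht0 ENNReal.ofReal_ne_top, hαβ, ENNReal.rpow_one]
      _ < f x ^ α * g y ^ β :=
          ENNReal.mul_lt_mul (ENNReal.rpow_lt_rpow hx hα) (ENNReal.rpow_lt_rpow hy hβ)
  · have ht' : 1 ≤ ENNReal.ofReal t := by simpa using ht1
    have h1 : {x | ENNReal.ofReal t < f x} = ∅ :=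
      eq_empty_of_forall_notMem fun x hx => absurd hx (not_lt.2 ((hfle x).trans ht'))
    have h2 : {x | ENNReal.ofReal t < g x} = ∅ :=
      eq_empty_of_forall_notMem fun x hx => absurd hx (not_lt.2 ((hgle x).trans ht'))
    simp [h1, h2]

theorem ENNReal.rpow_mul_rpow_le_add (x y : ℝ≥0∞) {α β : ℝ} (hα : 0 < α) (hβ : 0 < β)
    (hαβ : α + β = 1) :
    x ^ α * y ^ β ≤ ENNReal.ofReal α * x + ENNReal.ofReal β * y := by
  rcases eq_or_ne x ∞ with rfl | hx
  · simp [hα]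
  rcases eq_or_ne y ∞ with rfl | hy
  · simp [hβ]
  lift x to ℝ≥0 using hx
  lift y to ℝ≥0 using hy
  have := NNReal.geom_mean_le_arith_mean2_weighted ⟨α, hα.le⟩ ⟨β, hβ.le⟩ x y
    (NNReal.eq hαβ)
  rw [← ENNReal.coe_rpow_of_nonneg _ hα.le, ← ENNReal.coe_rpow_of_nonneg _ hβ.le,
    ENNReal.ofReal_eq_coe_nnreal hα.le, ENNReal.ofReal_eq_coe_nnreal hβ.le]
  exact_mod_cast this

theorem prekopa_leindler_of_bounded {f g h : ℝ → ℝ≥0∞} (hf : Measurable f)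
    (hg : Measurable g) (hh : Measurable h) {α β : ℝ} (hα : 0 < α) (hβ : 0 < β) (hαβ : α + β = 1)
    (hf1 : ⨆ x, f x ≠ ∞) (hg1 : ⨆ x, g x ≠ ∞)
    (H : ∀ x y, f x ^ α * g y ^ β ≤ h (α * x + β * y)) :
    (∫⁻ x, f x) ^ α * (∫⁻ x, g x) ^ β ≤ ∫⁻ x, h x := by
  set A := ⨆ x, f x with hA
  set B := ⨆ x, g x with hB
  rcases eq_or_ne A 0 with hA0 | hA0
  · have : ∀ x, f x = 0 := by simpa [hA] using hA0
    simp [this, hα]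
  rcases eq_or_ne B 0 with hB0 | hB0
  · have : ∀ x, g x = 0 := by simpa [hB] using hB0
    simp [this, hβ]
  have hc0 : A ^ α * B ^ β ≠ 0 :=
    mul_ne_zero (ENNReal.rpow_pos (pos_iff_ne_zero.2 hA0) hf1).ne'
      (ENNReal.rpow_pos (pos_iff_ne_zero.2 hB0) hg1).ne'
  have hct : A ^ α * B ^ β ≠ ∞ :=
    ENNReal.mul_ne_top (ENNReal.rpow_ne_top_of_nonneg hα.le hf1)
      (ENNReal.rpow_ne_top_of_nonneg hβ.le hg1)
  have hcinv : (A ^ α * B ^ β)⁻¹ = A⁻¹ ^ α * B⁻¹ ^ β := by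
    rw [ENNReal.mul_inv (Or.inr (ENNReal.rpow_ne_top_of_nonneg hβ.le hg1))
        (Or.inl (ENNReal.rpow_ne_top_of_nonneg hα.le hf1)),
      ENNReal.inv_rpow, ENNReal.inv_rpow]
  have key := prekopa_leindler_of_iSup_eq_one (hf.const_mul A⁻¹) (hg.const_mul B⁻¹)
    (hh.const_mul (A ^ α * B ^ β)⁻¹) hα hβ hαβ
    (by rw [← ENNReal.mul_iSup, ← hA, ENNReal.inv_mul_cancel hA0 hf1])
    (by rw [← ENNReal.mul_iSup, ← hB, ENNReal.inv_mul_cancel hB0 hg1])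
    (fun x y => by
      rw [ENNReal.mul_rpow_of_nonneg _ _ hα.le, ENNReal.mul_rpow_of_nonneg _ _ hβ.le,
        mul_mul_mul_comm, ← hcinv]
      exact mul_le_mul_right (H x y) _)
  have k2 := (ENNReal.rpow_mul_rpow_le_add _ _ hα hβ hαβ).trans key
  rw [lintegral_const_mul _ hf, lintegral_const_mul _ hg, lintegral_const_mul _ hh,
    ENNReal.mul_rpow_of_nonneg _ _ hα.le, ENNReal.mul_rpow_of_nonneg _ _ hβ.le,
        mul_mul_mul_comm, ← hcinv] at k2
  exact (ENNReal.mul_le_mul_iff_right (ENNReal.inv_ne_zero.2 hct)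
    (ENNReal.inv_ne_top.2 hc0)).1 k2

theorem prekopa_leindler_real {f g h : ℝ → ℝ≥0∞} (hf : Measurable f)
    (hg : Measurable g) (hh : Measurable h) {α β : ℝ} (hα : 0 < α) (hβ : 0 < β) (hαβ : α + β = 1)
    (H : ∀ x y, f x ^ α * g y ^ β ≤ h (α * x + β * y)) :
    (∫⁻ x, f x) ^ α * (∫⁻ x, g x) ^ β ≤ ∫⁻ x, h x := by
  rcases eq_or_ne (∫⁻ x, f x) 0 with hf0 | hf0
  · simp [hf0, hα]
  rcases eq_or_ne (∫⁻ x, g x) 0 with hg0 | hg0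
  · simp [hg0, hβ]
  have htr : ∀ u : ℝ → ℝ≥0∞, Measurable u →
      Tendsto (fun k : ℕ => ∫⁻ x, min (u x) k) atTop (𝓝 (∫⁻ x, u x)) := by
    intro u hu
    refine lintegral_tendsto_of_tendsto_of_monotone
      (fun k => (hu.min measurable_const).aemeasurable)
      (ae_of_all _ fun x i j hij => min_le_min le_rfl (by exact_mod_cast hij))
      (ae_of_all _ fun x => ?_)
    have := (tendsto_const_nhds (x := u x)).min ENNReal.tendsto_nat_nhds_top
    simpa using this
  have hlim : Tendsto (fun k : ℕ => (∫⁻ x, min (f x) k) ^ α * (∫⁻ x, min (g x) k) ^ β) atTop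
      (𝓝 ((∫⁻ x, f x) ^ α * (∫⁻ x, g x) ^ β)) := by
    refine ENNReal.Tendsto.mul ((ENNReal.continuous_rpow_const.tendsto _).comp (htr f hf))
      (Or.inl ?_) ((ENNReal.continuous_rpow_const.tendsto _).comp (htr g hg)) (Or.inl ?_)
    · simp [ENNReal.rpow_eq_zero_iff, hf0, hα.not_gt]
    · simp [ENNReal.rpow_eq_zero_iff, hg0, hβ.not_gt]
  refine le_of_tendsto' hlim fun k => ?_
  refine prekopa_leindler_of_bounded (hf.min measurable_const) (hg.min measurable_const) hh
    hα hβ hαβ ?_ ?_ fun x y => le_trans ?_ (H x y)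
  · exact ((iSup_le fun x => min_le_right _ _).trans_lt (ENNReal.natCast_lt_top k)).ne
  · exact ((iSup_le fun x => min_le_right _ _).trans_lt (ENNReal.natCast_lt_top k)).ne
  · gcongr <;> exact min_le_left _ _

theorem prekopa_leindler {α β : ℝ} (hα : 0 < α) (hβ : 0 < β) (hαβ : α + β = 1) (n : ℕ) :
    ∀ {f g h : (Fin n → ℝ) → ℝ≥0∞}, Measurable f → Measurable g → Measurable h →
    (∀ x y, f x ^ α * g y ^ β ≤ h (α • x + β • y)) →
    (∫⁻ x, f x) ^ α * (∫⁻ x, g x) ^ β ≤ ∫⁻ x, h x := by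
  induction n with
  | zero =>
    intro f g h hf hg hh H
    simp only [Measure.volume_pi_eq_dirac (α := fun _ : Fin 0 => ℝ) 0,
      lintegral_dirac]
    simpa using H 0 0
  | succ n ih =>
    intro f g h hf hg hh H
    let e := MeasurableEquiv.piFinSuccAbove (fun _ : Fin (n + 1) => ℝ) 0
    have split : ∀ u : (Fin (n + 1) → ℝ) → ℝ≥0∞, Measurable u →
        ∫⁻ x, u x = ∫⁻ a, ∫⁻ y, u (e.symm (a, y)) := by
      intro u hu
      rw [← lintegral_prod (fun z => u (e.symm z)) (hu.comp e.symm.measurable).aemeasurable]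
      exact ((volume_preserving_piFinSuccAbove (fun _ : Fin (n + 1) => ℝ) 0).symm
        e).lintegral_comp hu |>.symm
    have meas : ∀ u : (Fin (n + 1) → ℝ) → ℝ≥0∞, Measurable u →
        Measurable fun a => ∫⁻ y, u (e.symm (a, y)) := fun u hu =>
      (hu.comp e.symm.measurable).lintegral_prod_right'
    rw [split f hf, split g hg, split h hh]
    refine prekopa_leindler_real (meas f hf) (meas g hg) (meas h hh) hα hβ hαβ fun a b => ?_
    refine ih (hf.comp (e.symm.measurable.comp measurable_prodMk_left))
      (hg.comp (e.symm.measurable.comp measurable_prodMk_left))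
      (hh.comp (e.symm.measurable.comp measurable_prodMk_left)) fun x y => ?_
    refine (H _ _).trans (le_of_eq ?_)
    congr 1
    ext i
    refine Fin.cases ?_ (fun j => ?_) i
    · simp [e, MeasurableEquiv.piFinSuccAbove]
    · simp [e, MeasurableEquiv.piFinSuccAbove]

theorem volume_rpow_mul_volume_rpow_le {n : ℕ} {α β : ℝ} (hα : 0 < α) (hβ : 0 < β)
    (hαβ : α + β = 1) {A B C : Set (EuclideanSpace ℝ (Fin n))} (hA : MeasurableSet A)
    (hB : MeasurableSet B) (hC : MeasurableSet C)
    (H : ∀ x ∈ A, ∀ y ∈ B, α • x + β • y ∈ C) :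
    volume A ^ α * volume B ^ β ≤ volume C := by
  have mp := EuclideanSpace.volume_preserving_symm_measurableEquiv_toLp (Fin n)
  set e := (MeasurableEquiv.toLp 2 (Fin n → ℝ))
  have hv : ∀ S : Set (EuclideanSpace ℝ (Fin n)), MeasurableSet S →
      volume S = ∫⁻ x : Fin n → ℝ, (e ⁻¹' S).indicator 1 x := fun S hS => by
    rw [lintegral_indicator_one (e.measurable hS)]
    exact (mp.symm.measure_preimage_equiv S).symm
  rw [hv A hA, hv B hB, hv C hC]
  refine prekopa_leindler hα hβ hαβ n (measurable_const.indicator (e.measurable hA))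
    (measurable_const.indicator (e.measurable hB))
    (measurable_const.indicator (e.measurable hC)) fun x y => ?_
  by_cases hx : x ∈ e ⁻¹' A
  · by_cases hy : y ∈ e ⁻¹' B
    · have : α • x + β • y ∈ e ⁻¹' C := H _ hx _ hy
      simp [hx, hy, this]
    · simp [hy, hβ]
  · simp [hx, hα]

theorem volume_add_mul_rpow_le_volume_cthickening {n : ℕ} (hn : n ≠ 0)
    {A : Set (EuclideanSpace ℝ (Fin n))} (hA : IsCompact A) (hA0 : 0 < volume.real A) {h : ℝ}
    (hh : 0 < h) :
    volume.real A + h * (n * volume.real (Metric.ball (0 : EuclideanSpace ℝ (Fin n)) 1)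
      ^ (1 / n : ℝ) * volume.real A ^ (1 - 1 / n : ℝ)) ≤ volume.real (Metric.cthickening h A) := by
  have hn' : (0 : ℝ) < n := by positivity
  have : Nonempty (Fin n) := ⟨⟨0, Nat.pos_of_ne_zero hn⟩⟩
  set ω := volume.real (Metric.ball (0 : EuclideanSpace ℝ (Fin n)) 1) with hω
  set v := volume.real A with hv
  have hω0 : 0 < ω := ENNReal.toReal_pos (Metric.measure_ball_pos _ _ one_pos).ne' measure_ball_lt_top.ne
  set s := v ^ (1 / n : ℝ) with hs
  set t := h * ω ^ (1 / n : ℝ) with ht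
  have hs0 : 0 < s := by positivity
  have ht0 : 0 < t := by positivity
  have hsn : s ^ n = v := by
    rw [hs, ← Real.rpow_natCast, ← Real.rpow_mul hA0.le]; field_simp; simp
  have htn : t ^ n = h ^ n * ω := by
    rw [ht, mul_pow, ← Real.rpow_natCast (ω ^ _), ← Real.rpow_mul hω0.le]; field_simp; simp
  set α := s / (s + t) with hα
  set β := t / (s + t) with hβ
  have hα0 : 0 < α := by positivity
  have hβ0 : 0 < β := by positivity
  have hαβ : α + β = 1 := by rw [hα, hβ]; field_simp
  have hAfin : volume A ≠ ∞ := hA.measure_lt_top.ne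
  have e1 : volume (α⁻¹ • A) = ENNReal.ofReal ((s + t) ^ n) := by
    rw [Measure.addHaar_smul, finrank_euclideanSpace_fin, ← ofReal_measureReal hAfin,
      ← ENNReal.ofReal_mul (by positivity), abs_of_pos (by positivity), ← hv, ← hsn, ← mul_pow, hα]
    congr 2
    field_simp
  have e2 : volume (β⁻¹ • Metric.closedBall (0 : EuclideanSpace ℝ (Fin n)) h) = ENNReal.ofReal ((s + t) ^ n) := by
    rw [Measure.addHaar_smul, Measure.addHaar_closedBall _ _ hh.le, finrank_euclideanSpace_fin,
      ← ofReal_measureReal measure_ball_lt_top.ne,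
      ← ENNReal.ofReal_mul (by positivity), ← ENNReal.ofReal_mul (by positivity),
      abs_of_pos (by positivity), ← hω, ← htn, ← mul_pow, hβ]
    congr 2
    field_simp
  have hcomp : IsCompact (Metric.cthickening h A) := hA.cthickening
  have key := volume_rpow_mul_volume_rpow_le hα0 hβ0 hαβ
    (A := α⁻¹ • A) (B := β⁻¹ • Metric.closedBall (0 : EuclideanSpace ℝ (Fin n)) h) (C := Metric.cthickening h A)
    (hA.smul _).measurableSet ((isCompact_closedBall _ _).smul _).measurableSet
    hcomp.measurableSet (by
      rintro _ ⟨x, hx, rfl⟩ _ ⟨y, hy, rfl⟩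
      simp only [smul_smul, mul_inv_cancel₀ hα0.ne', mul_inv_cancel₀ hβ0.ne', one_smul]
      rw [← hA.add_closedBall_zero hh.le]
      exact add_mem_add hx hy)
  rw [e1, e2, ← ENNReal.rpow_add _ _ (by simp; positivity) ENNReal.ofReal_ne_top, hαβ,
    ENNReal.rpow_one, ENNReal.ofReal_le_iff_le_toReal hcomp.measure_lt_top.ne] at key
  refine le_trans ?_ key
  have hb := one_add_mul_le_pow (a := t / s) (by have : 0 < t / s := by positivity
                                                 linarith) n
  have h3 : v ^ (1 - 1 / n : ℝ) = s ^ n / s := by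
    rw [Real.rpow_sub hA0, Real.rpow_one, ← hs, hsn]
  calc v + h * (n * ω ^ (1 / n : ℝ) * v ^ (1 - 1 / n : ℝ))
      = s ^ n * (1 + n * (t / s)) := by rw [h3, ht, ← hsn]; field_simp
    _ ≤ s ^ n * (1 + t / s) ^ n := by gcongr
    _ = (s + t) ^ n := by rw [← mul_pow]; congr 1; field_simp

/-- The supremum of `w` over the closed ball of radius `h` centred at `x`. -/
def ballSup {E : Type*} [NormedAddCommGroup E] (w : E → ℝ) (h : ℝ) (x : E) : ℝ :=
  sSup ((fun z => w (x + z)) '' Metric.closedBall 0 h)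

theorem ballSup_le {E : Type*} [NormedAddCommGroup E] {w : E → ℝ} {h : ℝ} (hh : 0 ≤ h) {x : E} {c : ℝ} (hc : ∀ z, ‖z‖ ≤ h → w (x + z) ≤ c) :
    ballSup w h x ≤ c := by
  refine csSup_le ((Metric.nonempty_closedBall.2 hh).image _) ?_
  rintro _ ⟨z, hz, rfl⟩
  exact hc z (by simpa using hz)

section ballSup

variable {E : Type*} [NormedAddCommGroup E] [ProperSpace E] {w : E → ℝ} {h : ℝ}

theorem continuous_ballSup (hw : Continuous w) : Continuous (ballSup w h) :=
  (isCompact_closedBall (0 : E) h).continuous_sSup (f := fun x z => w (x + z))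
    (hw.comp (continuous_fst.add continuous_snd))

theorem le_ballSup (hw : Continuous w) (x : E) {z : E} (hz : ‖z‖ ≤ h) :
    w (x + z) ≤ ballSup w h x :=
  le_csSup ((isCompact_closedBall (0 : E) h).image
    (hw.comp (continuous_const.add continuous_id))).bddAbove ⟨z, by simpa using hz, rfl⟩

theorem self_le_ballSup (hw : Continuous w) (hh : 0 ≤ h) (x : E) : w x ≤ ballSup w h x := by
  simpa using le_ballSup hw x (z := 0) (by simpa using hh)

theorem cthickening_superlevel_subset (hw : Continuous w) (hh : 0 ≤ h) {τ : ℝ}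
    (hc : IsCompact {x | τ ≤ w x}) :
    Metric.cthickening h {x | τ ≤ w x} ⊆ {x | τ ≤ ballSup w h x} := by
  rw [← hc.add_closedBall_zero hh]
  rintro _ ⟨a, ha, b, hb, rfl⟩
  have := le_ballSup hw (a + b) (z := -b) (h := h) (by simpa using hb)
  simp only [add_neg_cancel_right] at this
  exact le_trans ha this

end ballSup

theorem isCompact_superlevel {X : Type*} [TopologicalSpace X] [R1Space X] {w : X → ℝ}
    (hw : Continuous w)
    (hc : HasCompactSupport w) {τ : ℝ} (hτ : 0 < τ) : IsCompact {x | τ ≤ w x} :=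
  hc.isCompact.of_isClosed_subset (isClosed_le continuous_const hw) fun x hx =>
    subset_tsupport w (by
      have : τ ≤ w x := hx
      exact (hτ.trans_le this).ne')

theorem clamp_sub_le {s t r r' : ℝ} (h : r ≤ r') :
    min (max r' s) t - min (max r s) t ≤ r' - r := by
  rcases le_total r s with h1 | h1 <;> rcases le_total r' s with h2 | h2 <;>
  rcases le_total r t with h3 | h3 <;> rcases le_total r' t with h4 | h4 <;>
  rcases le_total s t with h5 | h5 <;>
  simp [*] <;> linarith

theorem eventually_ballSup_le {E : Type*} [NormedAddCommGroup E] [NormedSpace ℝ E]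
    {w : E → ℝ} {x : E} (hw : DifferentiableAt ℝ w x) {ε : ℝ}
    (hε : 0 < ε) : ∀ᶠ h in 𝓝[>] (0 : ℝ), ballSup w h x - w x ≤ h * (‖fderiv ℝ w x‖ + ε) := by
  have h1 := (hasFDerivAt_iff_isLittleO_nhds_zero.1 hw.hasFDerivAt).def hε
  obtain ⟨δ, hδ, hball⟩ := Metric.eventually_nhds_iff_ball.1 h1
  filter_upwards [Ioo_mem_nhdsGT hδ] with h hh
  rw [sub_le_iff_le_add]
  refine ballSup_le hh.1.le fun z hz => ?_
  have := hball z (by simpa using hz.trans_lt hh.2)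
  have h2 := (le_abs_self _).trans this
  have h3 := (le_abs_self _).trans ((fderiv ℝ w x).le_opNorm z)
  have h4 : ‖z‖ * (‖fderiv ℝ w x‖ + ε) ≤ h * (‖fderiv ℝ w x‖ + ε) := by gcongr
  linarith

theorem mul_volume_superlevel_rpow_le {n : ℕ} (hn : n ≠ 0) {w : EuclideanSpace ℝ (Fin n) → ℝ}
    (hd : Differentiable ℝ w) {L : ℝ≥0} (hL : LipschitzWith L w) (hc : HasCompactSupport w)
    {s t : ℝ} (hs : 0 < s) (hst : s < t) (ht : 0 < volume.real {x | t ≤ w x}) :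
    (t - s) * (n * volume.real (Metric.ball (0 : EuclideanSpace ℝ (Fin n)) 1)
      ^ (1 / n : ℝ) * volume.real {x | t ≤ w x} ^ (1 - 1 / n : ℝ)) ≤
      ∫ x in {x | s ≤ w x ∧ w x < t}, ‖fderiv ℝ w x‖ := by
  have hw := hd.continuous
  set κ := n * volume.real (Metric.ball (0 : EuclideanSpace ℝ (Fin n)) 1)
      ^ (1 / n : ℝ) with hκ
  have hκ0 : 0 ≤ κ := by positivity
  set M := volume.real {x | t ≤ w x} ^ (1 - 1 / n : ℝ) with hM
  have hM0 : 0 ≤ M := by positivity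
  have hn1 : (0 : ℝ) ≤ 1 - 1 / n := by
    have : (1 : ℝ) ≤ n := by exact_mod_cast Nat.one_le_iff_ne_zero.2 hn
    rw [sub_nonneg, div_le_one (by linarith)]; exact this
  set c : ℝ → ℝ := fun r => min (max r s) t - s with hcdef
  have hcc : Continuous c := by fun_prop
  have hcmono : Monotone c := fun a b hab => by simp only [hcdef]; gcongr
  have hc0 : ∀ r, 0 ≤ c r := fun r => by simp [hcdef, hst.le]
  have hcle : ∀ r, c r ≤ t - s := fun r => by simp [hcdef]
  have hclev : ∀ r τ, 0 < τ → τ ≤ t - s → (τ ≤ c r ↔ s + τ ≤ r) := fun r τ h1 h2 => by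
    simp only [hcdef, le_sub_iff_add_le, le_min_iff, le_max_iff]
    constructor
    · rintro ⟨h | h, -⟩ <;> linarith
    · intro h; exact ⟨Or.inl (by linarith), by linarith⟩
  have hcsmall : ∀ r, r ≤ s → c r = 0 := fun r hr => by simp [hcdef, hr, hst.le]
  have hcbig : ∀ r, t ≤ r → c r = t - s := fun r hr => by
    simp [hcdef, hr, hst.le.trans hr]
  -- level-set comparison between `w` and its supremum over balls
  have step1 : ∀ h : ℝ, 0 < h → ENNReal.ofReal ((t - s) * (κ * M)) ≤
      ∫⁻ x, ENNReal.ofReal ((c (ballSup w h x) - c (w x)) / h) := by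
    intro h hh
    have hm : Continuous (ballSup w h) := continuous_ballSup hw
    have hle : ∀ x, c (w x) ≤ c (ballSup w h x) := fun x => hcmono (self_le_ballSup hw hh.le x)
    have l1 := lintegral_eq_lintegral_meas_le (f := fun x => c (w x)) volume
      (ae_of_all _ fun x => hc0 _) (hcc.comp hw).measurable.aemeasurable
    have l2 := lintegral_eq_lintegral_meas_le (f := fun x => c (ballSup w h x)) volume
      (ae_of_all _ fun x => hc0 _) (hcc.comp hm).measurable.aemeasurable
    have hfin : ∫⁻ x, ENNReal.ofReal (c (w x)) ≠ ∞ := by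
      have hb : ∀ x, ENNReal.ofReal (c (w x)) ≤
          {x | s ≤ w x}.indicator (fun _ => ENNReal.ofReal (t - s)) x := fun x => by
        by_cases hx : s ≤ w x
        · simpa [hx] using ENNReal.ofReal_le_ofReal (hcle (w x))
        · simp [hx, hcsmall _ (not_le.1 hx).le]
      refine ((lintegral_mono hb).trans_lt ?_).ne
      rw [lintegral_indicator_const (isCompact_superlevel hw hc hs).measurableSet]
      exact ENNReal.mul_lt_top ENNReal.ofReal_lt_top (isCompact_superlevel hw hc hs).measure_lt_top
    have l3 : (∫⁻ x, ENNReal.ofReal (c (w x))) + ENNReal.ofReal (h * ((t - s) * (κ * M))) ≤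
        ∫⁻ x, ENNReal.ofReal (c (ballSup w h x)) := by
      rw [l1, l2]
      have e : ENNReal.ofReal (h * ((t - s) * (κ * M))) =
          ∫⁻ τ in Ioi (0 : ℝ), (Ioc 0 (t - s)).indicator
            (fun _ => ENNReal.ofReal (h * (κ * M))) τ := by
        rw [setLIntegral_indicator measurableSet_Ioc, inter_eq_left.2 Ioc_subset_Ioi_self,
          setLIntegral_const, Real.volume_Ioc, ← ENNReal.ofReal_mul (by positivity), sub_zero]
        congr 1; ring
      rw [e, ← lintegral_add_right _ (measurable_const.indicator measurableSet_Ioc)]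
      refine setLIntegral_mono' measurableSet_Ioi fun τ hτ => ?_
      by_cases hτ' : τ ≤ t - s
      · have hτ0 : 0 < τ := hτ
        have hcomp : IsCompact {x | s + τ ≤ w x} := isCompact_superlevel hw hc (by linarith)
        simp only [hclev _ τ hτ0 hτ', indicator_of_mem (show τ ∈ Ioc 0 (t - s) from ⟨hτ0, hτ'⟩)]
        have hsub : {x | t ≤ w x} ⊆ {x | s + τ ≤ w x} := fun x hx =>
          le_trans (by linarith) (show t ≤ w x from hx)
        have hvol : volume.real {x | t ≤ w x} ≤ volume.real {x | s + τ ≤ w x} :=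
          measureReal_mono hsub hcomp.measure_lt_top.ne
        have bm := volume_add_mul_rpow_le_volume_cthickening hn hcomp (ht.trans_le hvol) hh
        refine le_trans ?_ (measure_mono (cthickening_superlevel_subset hw hh.le hcomp))
        rw [← ofReal_measureReal hcomp.measure_lt_top.ne,
          ← ofReal_measureReal hcomp.cthickening.measure_lt_top.ne,
          ← ENNReal.ofReal_add (by positivity) (by positivity)]
        refine ENNReal.ofReal_le_ofReal (le_trans ?_ bm)
        have : M ≤ volume.real {x | s + τ ≤ w x} ^ (1 - 1 / n : ℝ) := by
          rw [hM]; gcongr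
        gcongr
      · rw [indicator_of_notMem (fun h => hτ' h.2), add_zero]
        exact measure_mono fun x hx => le_trans hx (hle x)
    have l4 : ∫⁻ x, ENNReal.ofReal (c (ballSup w h x)) = (∫⁻ x, ENNReal.ofReal (c (w x))) +
        ∫⁻ x, ENNReal.ofReal (c (ballSup w h x) - c (w x)) := by
      rw [← lintegral_add_left (f := fun x => ENNReal.ofReal (c (w x)))
        (hcc.comp hw).measurable.ennreal_ofReal]
      refine lintegral_congr fun x => ?_
      rw [← ENNReal.ofReal_add (hc0 _) (sub_nonneg.2 (hle x)), add_sub_cancel]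
    rw [l4, ENNReal.add_le_add_iff_left hfin] at l3
    simp only [div_eq_inv_mul, ENNReal.ofReal_mul (inv_nonneg.2 hh.le)]
    rw [lintegral_const_mul' _ _ ENNReal.ofReal_ne_top]
    calc ENNReal.ofReal ((t - s) * (κ * M))
        = ENNReal.ofReal h⁻¹ * ENNReal.ofReal (h * ((t - s) * (κ * M))) := by
          rw [← ENNReal.ofReal_mul (by positivity), inv_mul_cancel_left₀ hh.ne']
      _ ≤ _ := by gcongr
  -- pass to the limit along `h = 1 / (k + 1)`
  set η : ℕ → ℝ := fun k => 1 / ((k : ℝ) + 1) with hη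
  have hη0 : ∀ k, 0 < η k := fun k => by positivity
  have hη1 : ∀ k, η k ≤ 1 := fun k => by
    rw [hη]; simp only; rw [div_le_one (by positivity)]; simp
  have hηlim : Tendsto η atTop (𝓝[>] 0) :=
    tendsto_nhdsWithin_iff.2 ⟨tendsto_one_div_add_atTop_nhds_zero_nat, .of_forall hη0⟩
  set F : ℕ → EuclideanSpace ℝ (Fin n) → ℝ≥0∞ := fun k x =>
    ENNReal.ofReal ((c (ballSup w (η k) x) - c (w x)) / η k) with hF
  have hdiff : ∀ k x, c (ballSup w (η k) x) - c (w x) ≤ ballSup w (η k) x - w x := fun k x => by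
    have := clamp_sub_le (s := s) (t := t) (self_le_ballSup hw (hη0 k).le x)
    simp only [hcdef]; linarith
  have hFm : ∀ k, Measurable (F k) := fun k =>
    ((((hcc.comp (continuous_ballSup hw)).sub (hcc.comp hw)).div_const _).measurable).ennreal_ofReal
  have hKc : IsCompact (Metric.cthickening 1 (tsupport w)) := hc.isCompact.cthickening
  have hbound : ∀ k, F k ≤ᵐ[volume]
      (Metric.cthickening 1 (tsupport w)).indicator fun _ => (L : ℝ≥0∞) := by
    refine fun k => ae_of_all _ fun x => ?_
    by_cases hx : x ∈ Metric.cthickening 1 (tsupport w)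
    · rw [indicator_of_mem hx, ← ENNReal.ofReal_coe_nnreal]
      refine ENNReal.ofReal_le_ofReal ?_
      rw [div_le_iff₀ (hη0 k)]
      refine (hdiff k x).trans ?_
      rw [sub_le_iff_le_add]
      refine ballSup_le (hη0 k).le fun z hz => ?_
      have h1 := hL.dist_le_mul (x + z) x
      rw [dist_self_add_left, Real.dist_eq] at h1
      have h2 := (le_abs_self _).trans h1
      have h3 : (L : ℝ) * ‖z‖ ≤ L * η k := by gcongr
      linarith
    · have hz : ∀ z, ‖z‖ ≤ η k → w (x + z) = 0 := fun z hz => by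
        refine image_eq_zero_of_notMem_tsupport fun hxz => hx ?_
        exact Metric.mem_cthickening_of_dist_le x (x + z) 1 _ hxz
          (by simpa using hz.trans (hη1 k))
      have h0 : ballSup w (η k) x ≤ w x := ballSup_le (hη0 k).le fun z hz' => by
        rw [hz z hz', ← hz 0 (by simpa using (hη0 k).le), add_zero]
      have : c (ballSup w (η k) x) - c (w x) ≤ 0 := (hdiff k x).trans (by linarith)
      simp only [hF, indicator_of_notMem hx]
      rw [ENNReal.ofReal_of_nonpos (div_nonpos_of_nonpos_of_nonneg this (hη0 k).le)]
  have hfb : ∫⁻ x, (Metric.cthickening 1 (tsupport w)).indicator (fun _ => (L : ℝ≥0∞)) x ≠ ∞ := by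
    rw [lintegral_indicator_const hKc.measurableSet]
    exact (ENNReal.mul_lt_top ENNReal.coe_lt_top hKc.measure_lt_top).ne
  set S := {x | s ≤ w x ∧ w x < t} with hS
  have hSm : MeasurableSet S := (measurableSet_le measurable_const hw.measurable).inter
    (measurableSet_lt hw.measurable measurable_const)
  have hlimsup : ∀ x, limsup (fun k => F k x) atTop ≤
      S.indicator (fun x => ENNReal.ofReal ‖fderiv ℝ w x‖) x := by
    intro x
    by_cases hx : x ∈ S
    · rw [indicator_of_mem hx]
      refine ENNReal.le_of_forall_pos_le_add fun ε hε _ => ?_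
      rw [← ENNReal.ofReal_coe_nnreal, ← ENNReal.ofReal_add (norm_nonneg (fderiv ℝ w x)) ε.coe_nonneg]
      refine limsup_le_of_le (by isBoundedDefault) ?_
      filter_upwards [hηlim.eventually
        (eventually_ballSup_le (hd x) (ε := ε) (by exact_mod_cast hε))] with k hk
      refine ENNReal.ofReal_le_ofReal ?_
      rw [div_le_iff₀ (hη0 k), mul_comm]
      exact (hdiff k x).trans hk
    · rw [indicator_of_notMem hx]
      refine limsup_le_of_le (by isBoundedDefault) ?_
      rcases le_or_gt t (w x) with h1 | h1
      · refine .of_forall fun k => ?_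
        have : c (ballSup w (η k) x) - c (w x) ≤ 0 := by
          rw [hcbig (w x) h1]; linarith [hcle (ballSup w (η k) x)]
        simp only [hF]
        rw [ENNReal.ofReal_of_nonpos (div_nonpos_of_nonpos_of_nonneg this (hη0 k).le)]
      · have h2 : w x < s := by
          by_contra h; exact hx ⟨not_lt.1 h, h1⟩
        filter_upwards [hηlim.eventually (eventually_ballSup_le (hd x) one_pos),
          (tendsto_nhdsWithin_iff.1 hηlim).1.eventually
            (gt_mem_nhds (show 0 < (s - w x) / (‖fderiv ℝ w x‖ + 1) from
              div_pos (by linarith) (by positivity)))] with k hk hk2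
        rw [lt_div_iff₀ (by positivity)] at hk2
        simp only [hF]
        rw [hcsmall (w x) h2.le, hcsmall (ballSup w (η k) x) (by linarith)]
        simp
  have hfinal : ENNReal.ofReal ((t - s) * (κ * M)) ≤ ∫⁻ x in S, ENNReal.ofReal ‖fderiv ℝ w x‖ := by
    rw [← lintegral_indicator hSm]
    calc ENNReal.ofReal ((t - s) * (κ * M))
        ≤ limsup (fun k => ∫⁻ x, F k x) atTop :=
          le_limsup_of_frequently_le (Frequently.of_forall fun k => step1 _ (hη0 k))
            (by isBoundedDefault)
      _ ≤ ∫⁻ x, limsup (fun k => F k x) atTop := limsup_lintegral_le _ hFm hbound hfb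
      _ ≤ _ := lintegral_mono hlimsup
  have hSfin : volume S ≠ ∞ := ((measure_mono fun x hx => hx.1).trans_lt
    (isCompact_superlevel hw hc hs).measure_lt_top).ne
  have hint : IntegrableOn (fun x => ‖fderiv ℝ w x‖) S := by
    refine Measure.integrableOn_of_bounded (M := L) hSfin
      (measurable_fderiv ℝ w).norm.aestronglyMeasurable (ae_of_all _ fun x => ?_)
    rw [norm_norm]
    exact norm_fderiv_le_of_lipschitz ℝ hL
  rw [← ofReal_integral_eq_lintegral_ofReal hint (ae_of_all _ fun x => norm_nonneg _)] at hfinal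
  exact (ENNReal.ofReal_le_ofReal_iff (integral_nonneg fun x => norm_nonneg _)).1 hfinal

theorem rpow_neg_mul_sub_le {x y ρ : ℝ} (hx : 0 < x) (hy : 0 < y) (hρ : 0 < ρ) :
    y ^ (-(ρ + 1)) * (y - x) ≤ (x ^ (-ρ) - y ^ (-ρ)) / ρ := by
  have h1 : 1 - ρ * (x / y - 1) ≤ (x / y) ^ (-ρ) := by
    rw [Real.rpow_def_of_pos (by positivity)]
    have h2 := Real.add_one_le_exp (Real.log (x / y) * -ρ)
    have h3 := Real.log_le_sub_one_of_pos (show 0 < x / y by positivity)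
    nlinarith
  have h4 : x ^ (-ρ) = (x / y) ^ (-ρ) * y ^ (-ρ) := by
    rw [← Real.mul_rpow (by positivity) hy.le, div_mul_cancel₀ _ hy.ne']
  have h5 : y ^ (-(ρ + 1)) = y ^ (-ρ) / y := by
    rw [neg_add, ← sub_eq_add_neg, Real.rpow_sub_one hy.ne']
  rw [le_div_iff₀ hρ, h4, h5]
  have h6 : 0 < y ^ (-ρ) := by positivity
  calc y ^ (-ρ) / y * (y - x) * ρ = (1 - ρ * (x / y - 1)) * y ^ (-ρ) - y ^ (-ρ) := by
        field_simp; ring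
    _ ≤ _ := by gcongr

theorem card_mul_rpow_le_sum_div_rpow {m : ℕ → ℝ} (hm : ∀ i, 0 < m i) {α : ℝ} {N : ℕ}
    (hN : 0 < N) :
    N * (m N / m 0) ^ (α / N) ≤ ∑ i ∈ Finset.range N, (m (i + 1) / m i) ^ α := by
  have hN' : (0 : ℝ) < N := by exact_mod_cast hN
  have h := Real.geom_mean_le_arith_mean_weighted (Finset.range N) (fun _ => 1 / (N : ℝ))
    (fun i => (m (i + 1) / m i) ^ α) (fun _ _ => by positivity)
    (by simp [hN'.ne']) (fun i _ => (Real.rpow_pos_of_pos (div_pos (hm _) (hm _)) _).le)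
  have h2 : ∏ i ∈ Finset.range N, ((m (i + 1) / m i) ^ α) ^ (1 / (N : ℝ)) =
      (m N / m 0) ^ (α / N) := by
    have h3 : ∏ i ∈ Finset.range N, m (i + 1) / m i = m N / m 0 := by
      refine Finset.prod_range_induction _ (fun i => m i / m 0) (div_self (hm 0).ne') N fun k _ => ?_
      have := (hm k).ne'
      have := (hm 0).ne'
      field_simp
    rw [← h3,
      ← Real.finsetProd_rpow _ _ (fun i _ => (div_pos (hm _) (hm _)).le)]
    refine Finset.prod_congr rfl fun i _ => ?_
    rw [← Real.rpow_mul (div_pos (hm _) (hm _)).le, mul_one_div]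
  rw [h2, ← Finset.mul_sum] at h
  calc N * (m N / m 0) ^ (α / N) ≤ N * (1 / N *
        ∑ i ∈ Finset.range N, (m (i + 1) / m i) ^ α) := by gcongr
    _ = _ := by field_simp

theorem mul_sum_div_rpow_le {p q α ρ δ : ℝ} (hpq : p.HolderConjugate q) (hρ : 0 < ρ)
    (hα : α * q = ρ + 1) {N : ℕ} {m e : ℕ → ℝ} (hm : ∀ i, 0 < m i)
    (hanti : ∀ i, m (i + 1) ≤ m i) (he : ∀ i, 0 ≤ e i)
    (H : ∀ i < N, δ * m (i + 1) ^ α ≤ e i ^ (1 / p) * (m i - m (i + 1)) ^ (1 / q)) :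
    δ * ∑ i ∈ Finset.range N, (m (i + 1) / m i) ^ α ≤
      (∑ i ∈ Finset.range N, e i) ^ (1 / p) * (m N ^ (-ρ) / ρ) ^ (1 / q) := by
  have hp := hpq.pos
  have hq := hpq.symm.pos
  have hd : ∀ i, 0 ≤ m i - m (i + 1) := fun i => sub_nonneg.2 (hanti i)
  calc δ * ∑ i ∈ Finset.range N, (m (i + 1) / m i) ^ α
      ≤ ∑ i ∈ Finset.range N, e i ^ (1 / p) * (m i ^ (-α) * (m i - m (i + 1)) ^ (1 / q)) := by
        rw [Finset.mul_sum]
        refine Finset.sum_le_sum fun i hi => ?_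
        have h1 := H i (Finset.mem_range.1 hi)
        have h2 : 0 < m i ^ (-α) := Real.rpow_pos_of_pos (hm i) _
        rw [Real.div_rpow (hm _).le (hm _).le, div_eq_mul_inv, ← Real.rpow_neg (hm i).le]
        calc δ * (m (i + 1) ^ α * m i ^ (-α)) = (δ * m (i + 1) ^ α) * m i ^ (-α) := by ring
          _ ≤ (e i ^ (1 / p) * (m i - m (i + 1)) ^ (1 / q)) * m i ^ (-α) := by gcongr
          _ = _ := by ring
    _ ≤ (∑ i ∈ Finset.range N, (e i ^ (1 / p)) ^ p) ^ (1 / p) *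
        (∑ i ∈ Finset.range N, (m i ^ (-α) * (m i - m (i + 1)) ^ (1 / q)) ^ q) ^ (1 / q) :=
        Real.inner_le_Lp_mul_Lq_of_nonneg _ hpq (fun i _ => Real.rpow_nonneg (he i) _)
          (fun i _ => mul_nonneg (Real.rpow_nonneg (hm i).le _) (Real.rpow_nonneg (hd i) _))
    _ ≤ _ := by
        have e1 : ∀ i, (e i ^ (1 / p)) ^ p = e i := fun i => by
          rw [← Real.rpow_mul (he i), one_div_mul_cancel hp.ne', Real.rpow_one]
        simp only [e1]
        have e2 : ∑ i ∈ Finset.range N, (m i ^ (-α) * (m i - m (i + 1)) ^ (1 / q)) ^ q ≤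
            m N ^ (-ρ) / ρ := by
          calc _ ≤ ∑ i ∈ Finset.range N, (m (i + 1) ^ (-ρ) / ρ - m i ^ (-ρ) / ρ) := by
                refine Finset.sum_le_sum fun i _ => ?_
                rw [Real.mul_rpow (Real.rpow_nonneg (hm i).le _) (Real.rpow_nonneg (hd i) _),
                  ← Real.rpow_mul (hd i), one_div_mul_cancel hq.ne', Real.rpow_one,
                  ← Real.rpow_mul (hm i).le, neg_mul, hα, ← sub_div]
                exact rpow_neg_mul_sub_le (hm _) (hm i) hρ
            _ = m N ^ (-ρ) / ρ - m 0 ^ (-ρ) / ρ :=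
                Finset.sum_range_sub (fun i => m i ^ (-ρ) / ρ) N
            _ ≤ _ := sub_le_self _ (div_nonneg (Real.rpow_nonneg (hm 0).le _) hρ.le)
        have e3 : 0 ≤ ∑ i ∈ Finset.range N, e i := Finset.sum_nonneg fun i _ => he i
        have e4 : 0 ≤ ∑ i ∈ Finset.range N, (m i ^ (-α) * (m i - m (i + 1)) ^ (1 / q)) ^ q :=
          Finset.sum_nonneg fun i _ => Real.rpow_nonneg
            (mul_nonneg (Real.rpow_nonneg (hm i).le _) (Real.rpow_nonneg (hd i) _)) _
        gcongr

theorem integral_norm_fderiv_le_rpow_mul {n : ℕ} {p q : ℝ} (hpq : p.HolderConjugate q)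
    {w : EuclideanSpace ℝ (Fin n) → ℝ} {L : ℝ≥0} (hL : LipschitzWith L w)
    {S : Set (EuclideanSpace ℝ (Fin n))} (hS : volume S ≠ ∞) :
    ∫ x in S, ‖fderiv ℝ w x‖ ≤
      (∫ x in S, ‖fderiv ℝ w x‖ ^ p) ^ (1 / p) * volume.real S ^ (1 / q) := by
  have : IsFiniteMeasure (volume.restrict S) := ⟨by simpa using hS.lt_top⟩
  have h := integral_mul_le_Lp_mul_Lq_of_nonneg (μ := volume.restrict S) hpq
    (f := fun x => ‖fderiv ℝ w x‖) (g := fun _ => (1 : ℝ))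
    (ae_of_all _ fun x => norm_nonneg _) (ae_of_all _ fun x => zero_le_one)
    (MemLp.of_bound (measurable_fderiv ℝ w).norm.aestronglyMeasurable L
      (ae_of_all _ fun x => by rw [norm_norm]; exact norm_fderiv_le_of_lipschitz ℝ hL))
    (memLp_const 1)
  simpa using h

theorem integrable_norm_fderiv_rpow {n : ℕ} {p : ℝ} (hp : 0 < p)
    {w : EuclideanSpace ℝ (Fin n) → ℝ} {L : ℝ≥0} (hL : LipschitzWith L w)
    (hc : HasCompactSupport w) : Integrable fun x => ‖fderiv ℝ w x‖ ^ p := by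
  have hsupp : Function.support (fun x => ‖fderiv ℝ w x‖ ^ p) ⊆ tsupport w := fun x hx => by
    refine support_fderiv_subset ℝ fun h => hx ?_
    simp [h, hp.ne']
  rw [← integrableOn_iff_integrable_of_support_subset hsupp]
  refine Measure.integrableOn_of_bounded (M := (L : ℝ) ^ p) hc.isCompact.measure_lt_top.ne
    ((measurable_fderiv ℝ w).norm.pow_const p).aestronglyMeasurable (ae_of_all _ fun x => ?_)
  rw [Real.norm_of_nonneg (by positivity)]
  have := norm_fderiv_le_of_lipschitz ℝ hL (x₀ := x)
  gcongr

/-- The sharp isocapacitary inequality without weights. -/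
theorem volume_superlevel_rpow_le {n : ℕ} {p : ℝ} (hp : 1 ≤ p) (hpn : p < n)
    {w : EuclideanSpace ℝ (Fin n) → ℝ} (hd : Differentiable ℝ w) {L : ℝ≥0}
    (hL : LipschitzWith L w) (hc : HasCompactSupport w) :
    n * volume.real (Metric.ball (0 : EuclideanSpace ℝ (Fin n)) 1) ^ (p / n) *
      volume.real {x | 1 ≤ w x} ^ ((n - p) / n) ≤
      ((p - 1) / (n - p)) ^ (p - 1) * ∫ x, ‖fderiv ℝ w x‖ ^ p := by
  have hn0 : (0 : ℝ) < n := by linarith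
  have hn : n ≠ 0 := by rintro rfl; simp at hn0
  have hnp : 0 < n - p := sub_pos.2 hpn
  have hw := hd.continuous
  have hint := integrable_norm_fderiv_rpow (zero_lt_one.trans_le hp) hL hc
  have hint0 : ∀ S : Set (EuclideanSpace ℝ (Fin n)), 0 ≤ ∫ x in S, ‖fderiv ℝ w x‖ ^ p :=
    fun S => integral_nonneg fun x => by positivity
  set ω := volume.real (Metric.ball (0 : EuclideanSpace ℝ (Fin n)) 1) with hω
  set X := ∫ x, ‖fderiv ℝ w x‖ ^ p with hX
  set M := volume.real {x | 1 ≤ w x} with hM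
  have hX0 : 0 ≤ X := integral_nonneg fun x => by positivity
  rcases measureReal_nonneg (μ := volume) (s := {x | 1 ≤ w x}) |>.eq_or_lt with h0 | hM0
  · rw [← hM] at h0
    rw [← h0, Real.zero_rpow (div_pos hnp hn0).ne', mul_zero]
    have : 0 ≤ (p - 1) / (n - p) := div_nonneg (by linarith) hnp.le
    positivity
  rw [← hM] at hM0
  have hpos : ∀ t, 0 < t → t ≤ 1 → 0 < volume.real {x | t ≤ w x} := fun t h1 h2 =>
    hM0.trans_le (measureReal_mono (fun x hx => le_trans h2 (show 1 ≤ w x from hx))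
      (isCompact_superlevel hw hc h1).measure_lt_top.ne)
  have hω0 : 0 ≤ ω := measureReal_nonneg
  rcases hp.eq_or_lt with rfl | hp1
  · have key : ∀ k : ℕ, (1 - 1 / ((k : ℝ) + 2)) * (n * ω ^ (1 / n : ℝ) * M ^ (1 - 1 / n : ℝ)) ≤
        X := fun k => by
      have hk : 1 / ((k : ℝ) + 2) < 1 := by rw [div_lt_one (by positivity)]; linarith [k.cast_nonneg (α := ℝ)]
      refine (mul_volume_superlevel_rpow_le hn hd hL hc (by positivity) hk hM0).trans ?_
      simp only [Real.rpow_one] at hint hX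
      exact hX ▸ setIntegral_le_integral hint (ae_of_all _ fun x => norm_nonneg _)
    have hlim : Tendsto (fun k : ℕ => (1 - 1 / ((k : ℝ) + 2)) *
        (n * ω ^ (1 / n : ℝ) * M ^ (1 - 1 / n : ℝ))) atTop
        (𝓝 ((1 - 0) * (n * ω ^ (1 / n : ℝ) * M ^ (1 - 1 / n : ℝ)))) := by
      refine Tendsto.mul_const _ (tendsto_const_nhds.sub ?_)
      refine tendsto_const_nhds.div_atTop ?_
      exact tendsto_atTop_add_const_right _ _ tendsto_natCast_atTop_atTop
    have := le_of_tendsto' hlim key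
    have e : (n - 1 : ℝ) / n = 1 - 1 / n := by field_simp
    simpa [e] using this
  · set q := p / (p - 1) with hq
    have hp1' : 0 < p - 1 := sub_pos.2 hp1
    have hpq : p.HolderConjugate q := Real.HolderConjugate.conjExponent hp1
    have hp0 := hpq.pos
    have hq0 := hpq.symm.pos
    set α : ℝ := 1 - 1 / n with hα
    set ρ : ℝ := (n - p) / (n * (p - 1)) with hρ
    have hρ0 : 0 < ρ := by positivity
    have hαq : α * q = ρ + 1 := by rw [hα, hq, hρ]; field_simp; ring
    have hα0 : 0 ≤ α := by
      have : 0 < α * q := by linarith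
      exact (pos_of_mul_pos_left this hq0.le).le
    set c := n * ω ^ (1 / n : ℝ) with hcdef
    have hc0 : 0 ≤ c := by positivity
    set V := volume.real (tsupport w) with hV
    have hle : ∀ t, 0 < t → volume.real {x | t ≤ w x} ≤ V := fun t h =>
      measureReal_mono (fun x hx => subset_tsupport w (h.trans_le hx).ne')
        hc.isCompact.measure_lt_top.ne
    have hV0 : 0 < V := hM0.trans_le (hle 1 one_pos)
    have key : ∀ k : ℕ, ((k + 1 : ℕ) : ℝ) / ((k + 1 : ℕ) + 1) * c * (M / V) ^ (α / (k + 1 : ℕ)) ≤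
        X ^ (1 / p) * (M ^ (-ρ) / ρ) ^ (1 / q) := by
      intro k
      set N := k + 1 with hN
      have hN0 : (0 : ℝ) < N := by positivity
      set τ : ℕ → ℝ := fun i => min ((i + 1 : ℝ) / (N + 1)) 1 with hτ
      have hτ0 : ∀ i, 0 < τ i := fun i => lt_min (by positivity) one_pos
      have hτ1 : ∀ i, τ i ≤ 1 := fun i => min_le_right _ _
      have hτle : ∀ i ≤ N, τ i = (i + 1 : ℝ) / (N + 1) := fun i hi => by
        refine min_eq_left ?_
        rw [div_le_one (by positivity)]
        have : (i : ℝ) ≤ N := by exact_mod_cast hi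
        linarith
      have hτmono : ∀ i, τ i ≤ τ (i + 1) := fun i => by
        simp only [hτ]; push_cast; gcongr; linarith
      have hτN : τ N = 1 := by rw [hτle N le_rfl]; field_simp
      set m : ℕ → ℝ := fun i => volume.real {x | τ i ≤ w x} with hm
      have hcomp : ∀ i, IsCompact {x | τ i ≤ w x} := fun i => isCompact_superlevel hw hc (hτ0 i)
      set S : ℕ → Set (EuclideanSpace ℝ (Fin n)) := fun i => {x | τ i ≤ w x ∧ w x < τ (i + 1)}
        with hS
      have hSm : ∀ i, MeasurableSet (S i) := fun i =>
        (measurableSet_le measurable_const hw.measurable).inter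
          (measurableSet_lt hw.measurable measurable_const)
      have hsub : ∀ i, {x | τ (i + 1) ≤ w x} ⊆ {x | τ i ≤ w x} := fun i x hx =>
        (hτmono i).trans hx
      have hSvol : ∀ i, volume.real (S i) = m i - m (i + 1) := fun i => by
        rw [hm, ← measureReal_sdiff (hsub i) (hcomp _).measurableSet (hcomp _).measure_lt_top.ne]
        congr 1
        ext x
        simp [hS]
      have hSdisj : Pairwise (Function.onFun Disjoint S) := by
        have hmono : Monotone τ := monotone_nat_of_le_succ hτmono
        refine (pairwise_disjoint_on S).2 fun i j hij => disjoint_left.2 fun x hx hy => ?_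
        exact absurd (hx.2.trans_le (hmono (Nat.succ_le_of_lt hij))) (not_lt.2 hy.1)
      have hmain := mul_sum_div_rpow_le (N := N) (m := m) (δ := c / (N + 1))
        (e := fun i => ∫ x in S i, ‖fderiv ℝ w x‖ ^ p) hpq hρ0 hαq
        (fun i => hpos _ (hτ0 i) (hτ1 i))
        (fun i => measureReal_mono (hsub i) (hcomp i).measure_lt_top.ne)
        (fun i => hint0 _) (fun i hi => by
          rw [← hSvol i]
          refine le_trans ?_ (integral_norm_fderiv_le_rpow_mul hpq hL
            ((measure_mono fun x hx => hx.1).trans_lt (hcomp i).measure_lt_top).ne)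
          have hstep : τ (i + 1) - τ i = 1 / (N + 1) := by
            rw [hτle i hi.le, hτle (i + 1) hi]; push_cast; field_simp; ring
          have hlt : τ i < τ (i + 1) := by
            have : (0 : ℝ) < 1 / (N + 1) := by positivity
            linarith
          have := mul_volume_superlevel_rpow_le hn hd hL hc (hτ0 i) hlt
            (hpos _ (hτ0 _) (hτ1 _))
          rw [hstep] at this
          refine le_trans (le_of_eq ?_) this
          simp only [hcdef, hm]; ring)
      have hsum : ∑ i ∈ Finset.range N, ∫ x in S i, ‖fderiv ℝ w x‖ ^ p ≤ X := by
        rw [← integral_biUnion_finset _ (fun i _ => hSm i) (hSdisj.set_pairwise _)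
          (fun i _ => hint.integrableOn)]
        exact setIntegral_le_integral hint (ae_of_all _ fun x => by positivity)
      have hmN : m N = M := by simp only [hm, hτN, hM]
      have hag := card_mul_rpow_le_sum_div_rpow (m := m) (fun i => hpos _ (hτ0 i) (hτ1 i))
        (α := α) (N := N) (Nat.succ_pos k)
      rw [hmN] at hag hmain
      have hm0 : 0 < m 0 := hpos _ (hτ0 0) (hτ1 0)
      have hm0V : m 0 ≤ V := hle _ (hτ0 0)
      calc (N : ℝ) / (N + 1) * c * (M / V) ^ (α / N)
          = c / (N + 1) * (N * (M / V) ^ (α / N)) := by ring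
        _ ≤ c / (N + 1) * (N * (M / m 0) ^ (α / N)) := by gcongr
        _ ≤ c / (N + 1) * ∑ i ∈ Finset.range N, (m (i + 1) / m i) ^ α := by gcongr
        _ ≤ _ := hmain
        _ ≤ _ := by
          have : 0 ≤ ∑ i ∈ Finset.range N, ∫ x in S i, ‖fderiv ℝ w x‖ ^ p :=
            Finset.sum_nonneg fun i _ => hint0 _
          gcongr
    have hlim : Tendsto (fun k : ℕ => ((k + 1 : ℕ) : ℝ) / ((k + 1 : ℕ) + 1) * c *
        (M / V) ^ (α / (k + 1 : ℕ))) atTop (𝓝 (1 * c * (M / V) ^ (0 : ℝ))) := by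
      have h1 : Tendsto (fun k : ℕ => ((k + 1 : ℕ) : ℝ)) atTop atTop :=
        tendsto_natCast_atTop_atTop.comp (tendsto_add_atTop_nat 1)
      refine Tendsto.mul (Tendsto.mul_const _ ?_) ?_
      · exact (tendsto_natCast_div_add_atTop (1 : ℝ)).comp (tendsto_add_atTop_nat 1)
      · exact ((Real.continuous_const_rpow (div_pos hM0 hV0).ne').tendsto 0).comp
          (tendsto_const_nhds.div_atTop h1)
    have hfin := le_of_tendsto' hlim key
    rw [one_mul, Real.rpow_zero, mul_one] at hfin
    have hp' := Real.rpow_le_rpow hc0 hfin hp0.le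
    have hMρ : 0 < M ^ (-ρ) / ρ := by positivity
    have e0 : c ^ p = (n : ℝ) ^ p * ω ^ (p / n) := by
      rw [hcdef, Real.mul_rpow (by positivity) (by positivity), ← Real.rpow_mul hω0,
        show 1 / (n : ℝ) * p = p / n by ring]
    have e3 : (X ^ (1 / p) * (M ^ (-ρ) / ρ) ^ (1 / q)) ^ p =
        X * ((M ^ ((n - p) / n))⁻¹ / ρ ^ (p - 1)) := by
      rw [Real.mul_rpow (by positivity) (by positivity), ← Real.rpow_mul hX0,
        ← Real.rpow_mul hMρ.le, one_div_mul_cancel hp0.ne', Real.rpow_one,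
        show 1 / q * p = p - 1 by rw [hq]; field_simp, Real.div_rpow (by positivity) hρ0.le,
        ← Real.rpow_mul hM0.le,
        show -ρ * (p - 1) = -((n - p) / n) by rw [hρ]; field_simp, Real.rpow_neg hM0.le]
    rw [e0, e3] at hp'
    have e1 : ρ ^ (p - 1) = (((p - 1) / (n - p)) ^ (p - 1))⁻¹ / (n : ℝ) ^ (p - 1) := by
      rw [← Real.inv_rpow (by positivity), ← Real.div_rpow (by positivity) hn0.le]
      congr 1; rw [hρ]; field_simp
    have e2 : (n : ℝ) ^ p = n * (n : ℝ) ^ (p - 1) := by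
      rw [Real.rpow_sub_one hn0.ne']; field_simp
    rw [e1, e2] at hp'
    have h1 : 0 < (n : ℝ) ^ (p - 1) := by positivity
    have h2 : 0 < M ^ ((n - p) / n) := by positivity
    have h3 : 0 < ((p - 1) / (n - p)) ^ (p - 1) := by positivity
    have h4 : n * ω ^ (p / n) * M ^ ((n - p) / n) =
        n * (n : ℝ) ^ (p - 1) * ω ^ (p / n) * (M ^ ((n - p) / n) / (n : ℝ) ^ (p - 1)) := by
      field_simp
    rw [h4]
    refine (mul_le_mul_of_nonneg_right hp' (by positivity)).trans (le_of_eq ?_)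
    field_simp

/-- The radial homeomorphism `y ↦ ‖y‖^(κ-1) y`. -/
def radialPow {n : ℕ} (κ : ℝ) (y : EuclideanSpace ℝ (Fin n)) : EuclideanSpace ℝ (Fin n) :=
  ‖y‖ ^ (κ - 1) • y

/-- The derivative of `radialPow κ`. -/
def radialPowDeriv {n : ℕ} (κ : ℝ) (y : EuclideanSpace ℝ (Fin n)) :
    EuclideanSpace ℝ (Fin n) →L[ℝ] EuclideanSpace ℝ (Fin n) :=
  ‖y‖ ^ (κ - 1) • (ContinuousLinearMap.id ℝ _ +
    (((κ - 1) * (‖y‖ ^ 2)⁻¹) • innerSL ℝ y).smulRight y)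

theorem norm_radialPow {n : ℕ} {κ : ℝ} (hκ : 0 < κ) (y : EuclideanSpace ℝ (Fin n)) :
    ‖radialPow κ y‖ = ‖y‖ ^ κ := by
  rcases eq_or_ne y 0 with rfl | hy
  · simp [radialPow, hκ.ne']
  · rw [radialPow, norm_smul, Real.norm_of_nonneg (by positivity),
      Real.rpow_sub_one (norm_ne_zero_iff.2 hy), div_mul_cancel₀ _ (norm_ne_zero_iff.2 hy)]

theorem radialPow_inv_radialPow {n : ℕ} {κ : ℝ} (hκ : 0 < κ) (y : EuclideanSpace ℝ (Fin n)) :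
    radialPow κ⁻¹ (radialPow κ y) = y := by
  rcases eq_or_ne y 0 with rfl | hy
  · simp [radialPow]
  · have h := norm_pos_iff.2 hy
    rw [radialPow, norm_radialPow hκ, radialPow, smul_smul, ← Real.rpow_mul h.le,
      ← Real.rpow_add h, show κ * (κ⁻¹ - 1) + (κ - 1) = 0 by field_simp; ring, Real.rpow_zero,
      one_smul]

theorem radialPow_bijective {n : ℕ} {κ : ℝ} (hκ : 0 < κ) :
    Function.Bijective (radialPow (n := n) κ) :=
  Function.bijective_iff_has_inverse.2 ⟨radialPow κ⁻¹, radialPow_inv_radialPow hκ, fun x => by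
    simpa using radialPow_inv_radialPow (inv_pos.2 hκ) x⟩

theorem hasFDerivAt_radialPow {n : ℕ} {κ : ℝ} (hκ : 1 ≤ κ) (y : EuclideanSpace ℝ (Fin n)) :
    HasFDerivAt (radialPow κ) (radialPowDeriv κ y) y := by
  rcases hκ.eq_or_lt with rfl | hκ
  · have h1 : radialPow (n := n) 1 = id := by ext; simp [radialPow]
    have h2 : radialPowDeriv 1 y = ContinuousLinearMap.id ℝ _ := by
      ext; simp [radialPowDeriv]
    rw [h1, h2]
    exact hasFDerivAt_id y
  rcases eq_or_ne y 0 with rfl | hy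
  · have h2 : radialPowDeriv κ (0 : EuclideanSpace ℝ (Fin n)) = 0 := by
      ext; simp [radialPowDeriv, (sub_pos.2 hκ).ne']
    rw [h2, hasFDerivAt_iff_isLittleO_nhds_zero]
    have h3 : Tendsto (fun h : EuclideanSpace ℝ (Fin n) => ‖h‖ ^ (κ - 1)) (𝓝 0) (𝓝 0) := by
      have : Continuous fun h : EuclideanSpace ℝ (Fin n) => ‖h‖ ^ (κ - 1) :=
        continuous_norm.rpow_const fun _ => Or.inr (sub_pos.2 hκ).le
      simpa [Real.zero_rpow (sub_pos.2 hκ).ne'] using this.tendsto 0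
    have h4 := ((Asymptotics.isLittleO_one_iff ℝ).2 h3).smul_isBigO
      (Asymptotics.isBigO_refl (fun h : EuclideanSpace ℝ (Fin n) => h) (𝓝 0))
    simpa [radialPow] using h4
  · have hn := norm_pos_iff.2 hy
    have h1 : HasFDerivAt (fun x : EuclideanSpace ℝ (Fin n) => ‖x‖ ^ (κ - 1))
        (((κ - 1) * ‖y‖ ^ (κ - 1 - 2)) • innerSL ℝ y) y := by
      have h2 : HasFDerivAt (fun x : EuclideanSpace ℝ (Fin n) => (‖x‖ ^ 2) ^ ((κ - 1) / 2)) _ y :=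
        ((hasStrictFDerivAt_norm_sq y).hasFDerivAt).rpow_const (Or.inl (by positivity))
      have h3 : (fun x : EuclideanSpace ℝ (Fin n) => (‖x‖ ^ 2) ^ ((κ - 1) / 2)) =
          fun x => ‖x‖ ^ (κ - 1) := by
        ext x
        rw [← Real.rpow_natCast, ← Real.rpow_mul (norm_nonneg x)]
        congr 1; push_cast; ring
      rw [h3] at h2
      refine h2.congr_fderiv ?_
      rw [← Real.rpow_natCast, ← Real.rpow_mul hn.le]
      ext z
      simp
      rw [show (2 : ℝ) * ((κ - 1) / 2 - 1) = κ - 1 - 2 by ring]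
      ring
    refine (h1.smul (hasFDerivAt_id y)).congr_fderiv ?_
    ext1 z
    simp only [radialPowDeriv, add_apply, smul_apply,
      ContinuousLinearMap.smulRight_apply, id, ContinuousLinearMap.id_apply, smul_add, smul_smul,
      smul_eq_mul]
    congr 2
    rw [Real.rpow_sub hn, Real.rpow_two]
    ring

theorem norm_radialPowDeriv_le {n : ℕ} {κ : ℝ} (hκ : 1 ≤ κ) (y : EuclideanSpace ℝ (Fin n)) :
    ‖radialPowDeriv κ y‖ ≤ κ * ‖y‖ ^ (κ - 1) := by
  have h0 : 0 ≤ κ - 1 := sub_nonneg.2 hκ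
  have h1 : ‖(((κ - 1) * (‖y‖ ^ 2)⁻¹) • innerSL ℝ y).smulRight y‖ ≤ κ - 1 := by
    rw [ContinuousLinearMap.norm_smulRight_apply, norm_smul, innerSL_apply_norm,
      Real.norm_of_nonneg (by positivity)]
    rcases eq_or_ne y 0 with rfl | hy
    · simpa using hκ
    · have := norm_pos_iff.2 hy
      apply le_of_eq
      field_simp
  rw [radialPowDeriv, norm_smul, Real.norm_of_nonneg (by positivity), mul_comm]
  gcongr
  calc _ ≤ 1 + (κ - 1) := (norm_add_le _ _).trans
        (add_le_add ContinuousLinearMap.norm_id_le h1)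
    _ = κ := by ring

theorem det_radialPowDeriv {n : ℕ} (hn : 0 < n) {κ : ℝ} (hκ : 1 ≤ κ)
    (y : EuclideanSpace ℝ (Fin n)) :
    (radialPowDeriv κ y).det = κ * ‖y‖ ^ ((κ - 1) * n) := by
  have h1 : (radialPowDeriv κ y).det = (‖y‖ ^ (κ - 1)) ^ n *
      (1 + (κ - 1) * (‖y‖ ^ 2)⁻¹ * ‖y‖ ^ 2) := by
    have h2 : ((radialPowDeriv κ y : EuclideanSpace ℝ (Fin n) →L[ℝ] EuclideanSpace ℝ (Fin n)) :
        EuclideanSpace ℝ (Fin n) →ₗ[ℝ] EuclideanSpace ℝ (Fin n)) =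
        ‖y‖ ^ (κ - 1) • LinearMap.transvection
          ((((κ - 1) * (‖y‖ ^ 2)⁻¹) • innerSL ℝ y :
            EuclideanSpace ℝ (Fin n) →L[ℝ] ℝ) : EuclideanSpace ℝ (Fin n) →ₗ[ℝ] ℝ) y := by
      ext1 z
      simp [radialPowDeriv, LinearMap.transvection]
    rw [ContinuousLinearMap.det, h2, LinearMap.det_smul, LinearMap.transvection.det]
    simp
  rw [h1, ← Real.rpow_natCast, ← Real.rpow_mul (norm_nonneg y)]
  rcases eq_or_ne y 0 with rfl | hy
  · rcases hκ.eq_or_lt with rfl | hκ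
    · simp
    · have : (κ - 1) * n ≠ 0 := mul_ne_zero (sub_pos.2 hκ).ne' (by positivity)
      simp [Real.zero_rpow this]
  · have := norm_pos_iff.2 hy
    field_simp
    ring

theorem integral_radialPow {n : ℕ} (hn : 0 < n) {κ : ℝ} (hκ : 1 ≤ κ)
    (g : EuclideanSpace ℝ (Fin n) → ℝ) :
    ∫ x, g x = ∫ y, κ * ‖y‖ ^ ((κ - 1) * n) * g (radialPow κ y) := by
  have hb := radialPow_bijective (n := n) (zero_lt_one.trans_le hκ)
  have h := integral_image_eq_integral_abs_det_fderiv_smul volume MeasurableSet.univ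
    (fun x _ => (hasFDerivAt_radialPow (n := n) hκ x).hasFDerivWithinAt) hb.1.injOn g
  rw [image_univ, hb.2.range_eq, setIntegral_univ, setIntegral_univ] at h
  rw [h]
  refine integral_congr_ae (ae_of_all _ fun y => ?_)
  simp only [det_radialPowDeriv hn hκ, smul_eq_mul]
  rw [abs_of_nonneg (by positivity)]

theorem setIntegral_radialPow {n : ℕ} (hn : 0 < n) {κ : ℝ} (hκ : 1 ≤ κ)
    {L : Set (EuclideanSpace ℝ (Fin n))} (hL : MeasurableSet L)
    (g : EuclideanSpace ℝ (Fin n) → ℝ) :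
    ∫ x in L, g x = ∫ y in radialPow κ ⁻¹' L, κ * ‖y‖ ^ ((κ - 1) * n) * g (radialPow κ y) := by
  have hG : Continuous (radialPow (n := n) κ) := continuous_iff_continuousAt.2 fun x =>
    (hasFDerivAt_radialPow hκ x).continuousAt
  rw [← integral_indicator hL, integral_radialPow hn hκ,
    ← integral_indicator (hG.measurable hL)]
  congr 1; ext y
  by_cases hy : radialPow κ y ∈ L <;> simp [indicator, hy]

theorem HasCompactSupport.comp_radialPow {n : ℕ} {κ : ℝ} (hκ : 1 ≤ κ)
    {v : EuclideanSpace ℝ (Fin n) → ℝ} (hc : HasCompactSupport v) :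
    HasCompactSupport (v ∘ radialPow κ) := by
  obtain ⟨R, hR⟩ := hc.isCompact.isBounded.subset_closedBall 0
  refine HasCompactSupport.intro (isCompact_closedBall 0 (max R 1)) fun y hy => ?_
  rw [Metric.mem_closedBall, dist_zero_right, not_le, max_lt_iff] at hy
  refine image_eq_zero_of_notMem_tsupport (f := v) fun h => ?_
  have h1 := hR h
  rw [Metric.mem_closedBall, dist_zero_right, norm_radialPow (zero_lt_one.trans_le hκ)] at h1
  have h2 := Real.rpow_le_rpow_of_exponent_le hy.2.le hκ
  rw [Real.rpow_one] at h2
  linarith [hy.1]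

theorem continuous_radialPow {n : ℕ} {κ : ℝ} (hκ : 1 ≤ κ) :
    Continuous (radialPow (n := n) κ) :=
  continuous_iff_continuousAt.2 fun x => (hasFDerivAt_radialPow hκ x).continuousAt

theorem norm_fderiv_comp_radialPow_le {n : ℕ} {κ : ℝ} (hκ : 1 ≤ κ)
    {v : EuclideanSpace ℝ (Fin n) → ℝ} (hd : Differentiable ℝ v)
    (y : EuclideanSpace ℝ (Fin n)) :
    ‖fderiv ℝ (v ∘ radialPow κ) y‖ ≤ ‖fderiv ℝ v (radialPow κ y)‖ * (κ * ‖y‖ ^ (κ - 1)) := by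
  rw [((hd _).hasFDerivAt.comp y (hasFDerivAt_radialPow hκ y)).fderiv]
  exact (ContinuousLinearMap.opNorm_comp_le _ _).trans
    (mul_le_mul_of_nonneg_left (norm_radialPowDeriv_le hκ y) (norm_nonneg _))

theorem continuous_norm_fderiv_comp_radialPow {n : ℕ} {κ : ℝ} (hκ : 1 ≤ κ)
    {v : EuclideanSpace ℝ (Fin n) → ℝ} (hv : ContDiff ℝ (⊤ : ℕ∞) v) :
    Continuous fun y => ‖fderiv ℝ v (radialPow κ y)‖ * (κ * ‖y‖ ^ (κ - 1)) :=
  ((hv.continuous_fderiv (by simp)).comp (continuous_radialPow hκ)).norm.mul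
    (continuous_const.mul (continuous_norm.rpow_const fun _ => Or.inr (sub_nonneg.2 hκ)))

theorem hasCompactSupport_norm_fderiv_comp_radialPow {n : ℕ} {κ : ℝ} (hκ : 1 ≤ κ)
    {v : EuclideanSpace ℝ (Fin n) → ℝ} (hc : HasCompactSupport v) :
    HasCompactSupport fun y => ‖fderiv ℝ v (radialPow κ y)‖ * (κ * ‖y‖ ^ (κ - 1)) :=
  HasCompactSupport.mul_right
    (HasCompactSupport.comp_radialPow (v := fun x => ‖fderiv ℝ v x‖) hκ (hc.fderiv ℝ).norm)

theorem exists_lipschitzWith_comp_radialPow {n : ℕ} {κ : ℝ} (hκ : 1 ≤ κ)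
    {v : EuclideanSpace ℝ (Fin n) → ℝ} (hv : ContDiff ℝ (⊤ : ℕ∞) v) (hc : HasCompactSupport v) :
    ∃ C : ℝ≥0, LipschitzWith C (v ∘ radialPow κ) := by
  have hvd : Differentiable ℝ v := hv.differentiable (by simp)
  obtain ⟨C, hC⟩ := (hasCompactSupport_norm_fderiv_comp_radialPow hκ hc).exists_bound_of_continuous
    (continuous_norm_fderiv_comp_radialPow hκ hv)
  refine ⟨C.toNNReal, lipschitzWith_of_nnnorm_fderiv_le (𝕜 := ℝ)
    (fun y => (hvd _).comp y (hasFDerivAt_radialPow hκ y).differentiableAt) fun y => ?_⟩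
  rw [← NNReal.coe_le_coe, coe_nnnorm]
  exact (norm_fderiv_comp_radialPow_le hκ hvd y).trans
    (((le_abs_self _).trans (hC y)).trans (Real.le_coe_toNNReal C))

theorem integral_norm_fderiv_comp_radialPow_le {n : ℕ} (hn : 0 < n) {p a κ : ℝ} (hp : 0 < p)
    (hκ : 1 ≤ κ) (h : κ * (n - p - a) = n - p) {v : EuclideanSpace ℝ (Fin n) → ℝ}
    (hv : ContDiff ℝ (⊤ : ℕ∞) v) (hc : HasCompactSupport v) :
    ∫ y, ‖fderiv ℝ (v ∘ radialPow κ) y‖ ^ p ≤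
      κ ^ (p - 1) * ∫ x, ‖fderiv ℝ v x‖ ^ p * ‖x‖ ^ (-a) := by
  have hκ0 : 0 < κ := by linarith
  obtain ⟨C, hC⟩ := exists_lipschitzWith_comp_radialPow hκ hv hc
  rw [integral_radialPow hn hκ fun x => ‖fderiv ℝ v x‖ ^ p * ‖x‖ ^ (-a), ← integral_const_mul]
  have hae : (fun y => (‖fderiv ℝ v (radialPow κ y)‖ * (κ * ‖y‖ ^ (κ - 1))) ^ p) =ᵐ[volume]
      fun y : EuclideanSpace ℝ (Fin n) => κ ^ (p - 1) * (κ * ‖y‖ ^ ((κ - 1) * n) *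
        (‖fderiv ℝ v (radialPow κ y)‖ ^ p * ‖radialPow κ y‖ ^ (-a))) := by
    have : Nonempty (Fin n) := ⟨⟨0, hn⟩⟩
    filter_upwards [compl_mem_ae_iff.2 (measure_singleton (0 : EuclideanSpace ℝ (Fin n)))]
      with y hy
    have hy0 : 0 < ‖y‖ := norm_pos_iff.2 hy
    have h1 : (κ - 1) * p = (κ - 1) * n + κ * (-a) := by linarith
    rw [norm_radialPow hκ0, Real.mul_rpow (norm_nonneg _) (by positivity),
      Real.mul_rpow hκ0.le (by positivity), ← Real.rpow_mul hy0.le, ← Real.rpow_mul hy0.le, h1,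
      Real.rpow_add hy0, Real.rpow_sub_one hκ0.ne']
    field_simp
  rw [← integral_congr_ae hae]
  refine integral_mono
    (integrable_norm_fderiv_rpow hp hC (HasCompactSupport.comp_radialPow hκ hc)) ?_ fun y =>
    Real.rpow_le_rpow (norm_nonneg _)
      (norm_fderiv_comp_radialPow_le hκ (hv.differentiable (by simp)) y) hp.le
  exact Continuous.integrable_of_hasCompactSupport
    ((continuous_norm_fderiv_comp_radialPow hκ hv).rpow_const fun _ => Or.inr hp.le)
    ((hasCompactSupport_norm_fderiv_comp_radialPow hκ hc).comp_left
      (g := fun t : ℝ => t ^ p) (Real.zero_rpow hp.ne'))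

theorem weighted_volume_superlevel_rpow_le {n : ℕ} {p a κ : ℝ} (hp : 1 ≤ p) (hpn : p < n)
    (han : a < n - p) (hκ : 1 ≤ κ) (h : κ * (n - p - a) = n - p)
    {v : EuclideanSpace ℝ (Fin n) → ℝ} (hv : ContDiff ℝ (⊤ : ℕ∞) v) (hc : HasCompactSupport v) :
    n * volume.real (Metric.ball (0 : EuclideanSpace ℝ (Fin n)) 1) ^ (p / n) *
      volume.real (radialPow κ ⁻¹' {x | 1 ≤ v x}) ^ ((n - p) / n) ≤
      ((p - 1) / (n - p - a)) ^ (p - 1) * ∫ x, ‖fderiv ℝ v x‖ ^ p * ‖x‖ ^ (-a) := by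
  have hn0 : (0 : ℝ) < n := by linarith
  have hnp : 0 < n - p := by linarith
  have hnpa : 0 < n - p - a := by linarith
  have hp1 : 0 ≤ p - 1 := by linarith
  have hd : Differentiable ℝ (v ∘ radialPow κ) := fun y =>
    (hv.differentiable (by simp) _).comp y (hasFDerivAt_radialPow hκ y).differentiableAt
  obtain ⟨C, hC⟩ := exists_lipschitzWith_comp_radialPow hκ hv hc
  have hmain := volume_superlevel_rpow_le hp hpn hd hC (HasCompactSupport.comp_radialPow hκ hc)
  have hI := integral_norm_fderiv_comp_radialPow_le (by exact_mod_cast hn0) (by linarith) hκ h hv hc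
  refine hmain.trans ((mul_le_mul_of_nonneg_left hI (by positivity)).trans (le_of_eq ?_))
  rw [← mul_assoc, ← Real.mul_rpow (by positivity) (by linarith)]
  congr 2
  rw [div_mul_eq_mul_div, div_eq_div_iff hnp.ne' hnpa.ne']
  linear_combination (p - 1) * h

theorem card_mul_volume_ball_eq {n : ℕ} (hn : 0 < n) :
    n * volume.real (Metric.ball (0 : EuclideanSpace ℝ (Fin n)) 1) =
      2 * π ^ ((n : ℝ) / 2) / Real.Gamma ((n : ℝ) / 2) := by
  have hn' : (0 : ℝ) < n := by exact_mod_cast hn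
  have : Nonempty (Fin n) := ⟨⟨0, hn⟩⟩
  rw [measureReal_def, EuclideanSpace.volume_ball]
  have h1 : 0 < Real.Gamma ((n : ℝ) / 2) := Real.Gamma_pos_of_pos (by positivity)
  simp only [ENNReal.ofReal_one, one_pow, one_mul, Fintype.card_fin]
  rw [ENNReal.toReal_ofReal (div_nonneg (by positivity)
    (Real.Gamma_pos_of_pos (by positivity)).le), Real.Gamma_add_one (by positivity),
    Real.sqrt_eq_rpow, ← Real.rpow_natCast, ← Real.rpow_mul Real.pi_pos.le]
  rw [show 1 / 2 * (n : ℝ) = n / 2 by ring]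
  field_simp

theorem setIntegral_closedBall_norm {n : ℕ} (hn : 0 < n) (f : ℝ → ℝ) {R : ℝ} (hR : 0 ≤ R) :
    ∫ x in Metric.closedBall (0 : EuclideanSpace ℝ (Fin n)) R, f ‖x‖ =
      2 * π ^ ((n : ℝ) / 2) / Real.Gamma ((n : ℝ) / 2) *
        ∫ r in (0)..R, r ^ (n - 1) * f r := by
  have : Nonempty (Fin n) := ⟨⟨0, hn⟩⟩
  have h1 := integral_fun_norm_addHaar (volume : Measure (EuclideanSpace ℝ (Fin n)))
    ((Iic R).indicator f)
  have h2 : (fun x : EuclideanSpace ℝ (Fin n) => (Iic R).indicator f ‖x‖) =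
      (Metric.closedBall (0 : EuclideanSpace ℝ (Fin n)) R).indicator fun x => f ‖x‖ := by
    ext x; simp [indicator]
  rw [h2, integral_indicator Metric.isClosed_closedBall.measurableSet] at h1
  rw [h1, ← card_mul_volume_ball_eq hn, finrank_euclideanSpace_fin,
    intervalIntegral.integral_of_le hR, nsmul_eq_mul, smul_eq_mul, mul_assoc]
  congr 2
  have h3 : (fun y : ℝ => y ^ (n - 1) • (Iic R).indicator f y) =
      (Iic R).indicator fun r => r ^ (n - 1) * f r := by
    ext y; by_cases h : y ∈ Iic R <;> simp [h]
  rw [h3, setIntegral_indicator measurableSet_Iic, Ioi_inter_Iic]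

theorem setIntegral_closedBall_norm_rpow {n : ℕ} (hn : 0 < n) {b : ℝ} (hb : b < n) {R : ℝ}
    (hR : 0 ≤ R) :
    ∫ x in Metric.closedBall (0 : EuclideanSpace ℝ (Fin n)) R, ‖x‖ ^ (-b) =
      2 * π ^ ((n : ℝ) / 2) / Real.Gamma ((n : ℝ) / 2) * (R ^ (n - b) / (n - b)) := by
  rw [setIntegral_closedBall_norm hn (fun r => r ^ (-b)) hR]
  congr 1
  have h1 : ∫ r in (0)..R, r ^ (n - 1) * r ^ (-b) = ∫ r in (0)..R, r ^ (n - 1 - b) := by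
    refine intervalIntegral.integral_congr_uIoo fun r hr => ?_
    rw [uIoo_of_le hR] at hr
    rw [← Real.rpow_natCast, ← Real.rpow_add hr.1, Nat.cast_sub hn]
    congr 1; push_cast; ring
  rw [h1, integral_rpow (Or.inl (by linarith))]
  rw [show (n : ℝ) - 1 - b + 1 = n - b by ring, Real.zero_rpow (by linarith), sub_zero]

theorem locallyIntegrable_norm_rpow {n : ℕ} (hn : 0 < n) {b : ℝ} (hb : b < n) :
    LocallyIntegrable fun x : EuclideanSpace ℝ (Fin n) => ‖x‖ ^ (-b) := by
  have : Nonempty (Fin n) := ⟨⟨0, hn⟩⟩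
  refine locallyIntegrable_of_norm_le_rpow (C := 1) (α := b) (by simpa using Nat.succ_le_of_lt hn)
    (by simpa using hb)
    (ae_of_all _ fun x => ?_)
    (measurable_norm.pow_const _).aestronglyMeasurable
  rw [one_mul, Real.norm_of_nonneg (by positivity)]

theorem setIntegral_norm_rpow_le_of_le {n : ℕ} (hn : 0 < n) {s b : ℝ} (hsb : s ≤ b) (hb : b < n)
    {R : ℝ} (hR : 0 < R) {L : Set (EuclideanSpace ℝ (Fin n))} (hL : IsCompact L)
    (h : ∫ x in L, ‖x‖ ^ (-s) ≤ ∫ x in Metric.closedBall (0 : EuclideanSpace ℝ (Fin n)) R, ‖x‖ ^ (-s)) :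
    ∫ x in L, ‖x‖ ^ (-b) ≤ ∫ x in Metric.closedBall (0 : EuclideanSpace ℝ (Fin n)) R, ‖x‖ ^ (-b) := by
  have : Nonempty (Fin n) := ⟨⟨0, hn⟩⟩
  have hB := isCompact_closedBall (0 : EuclideanSpace ℝ (Fin n)) R
  have ib := locallyIntegrable_norm_rpow hn hb
  have hsi := locallyIntegrable_norm_rpow hn (hsb.trans_lt hb)
  set c := R ^ (s - b) with hc
  have hc0 : 0 < c := Real.rpow_pos_of_pos hR _
  have key : ∀ {T : Set (EuclideanSpace ℝ (Fin n))}, IsCompact T →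
      ∫ x in T, (‖x‖ ^ (-b) - c * ‖x‖ ^ (-s)) =
        (∫ x in T, ‖x‖ ^ (-b)) - c * ∫ x in T, ‖x‖ ^ (-s) := fun hT => by
    rw [integral_sub (ib.integrableOn_isCompact hT) ((hsi.integrableOn_isCompact hT).const_mul c),
      integral_const_mul]
  have hle : ∫ x in L, (‖x‖ ^ (-b) - c * ‖x‖ ^ (-s)) ≤
      ∫ x in Metric.closedBall (0 : EuclideanSpace ℝ (Fin n)) R, (‖x‖ ^ (-b) - c * ‖x‖ ^ (-s)) := by
    have hi : ∀ {T : Set (EuclideanSpace ℝ (Fin n))}, IsCompact T →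
        IntegrableOn (fun x => ‖x‖ ^ (-b) - c * ‖x‖ ^ (-s)) T := fun hT =>
      (ib.integrableOn_isCompact hT).sub ((hsi.integrableOn_isCompact hT).const_mul c)
    rw [← integral_indicator hL.measurableSet, ← integral_indicator hB.measurableSet]
    refine integral_mono_ae ((hi hL).integrable_indicator hL.measurableSet)
      ((hi hB).integrable_indicator hB.measurableSet) ?_
    filter_upwards [compl_mem_ae_iff.2 (measure_singleton (0 : EuclideanSpace ℝ (Fin n)))]
      with x hx
    have hx0 : 0 < ‖x‖ := norm_pos_iff.2 hx
    have hf : ‖x‖ ^ (-b) - c * ‖x‖ ^ (-s) = (‖x‖ ^ (s - b) - c) * ‖x‖ ^ (-s) := by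
      rw [sub_mul, ← Real.rpow_add hx0]; congr 2; ring
    have hs0 : 0 ≤ ‖x‖ ^ (-s) := by positivity
    by_cases h2 : x ∈ Metric.closedBall (0 : EuclideanSpace ℝ (Fin n)) R
    · rw [indicator_of_mem h2]
      have h3 : c ≤ ‖x‖ ^ (s - b) :=
        Real.rpow_le_rpow_of_nonpos hx0 (by simpa using h2) (by linarith)
      have h4 : 0 ≤ ‖x‖ ^ (-b) - c * ‖x‖ ^ (-s) := hf ▸ mul_nonneg (sub_nonneg.2 h3) hs0
      exact indicator_apply_le' (fun _ => le_rfl) fun _ => h4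
    · rw [indicator_of_notMem h2]
      have h3 : ‖x‖ ^ (s - b) ≤ c :=
        Real.rpow_le_rpow_of_nonpos hR (by simpa using le_of_lt (by simpa using h2)) (by linarith)
      refine indicator_apply_le' (fun _ => ?_) fun _ => le_rfl
      rw [hf]
      exact mul_nonpos_of_nonpos_of_nonneg (sub_nonpos.2 h3) hs0
  rw [key hL, key hB] at hle
  have := mul_le_mul_of_nonneg_left h hc0.le
  linarith

theorem setIntegral_norm_rpow_eq_mul_volume {n : ℕ} (hn : 0 < n) {s κ : ℝ} (hκ : 1 ≤ κ)
    (hs : κ * s = (κ - 1) * n) {L : Set (EuclideanSpace ℝ (Fin n))} (hL : MeasurableSet L) :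
    ∫ x in L, ‖x‖ ^ (-s) = κ * volume.real (radialPow κ ⁻¹' L) := by
  have : Nonempty (Fin n) := ⟨⟨0, hn⟩⟩
  rw [setIntegral_radialPow hn hκ hL]
  have h : (fun y : EuclideanSpace ℝ (Fin n) =>
      κ * ‖y‖ ^ ((κ - 1) * n) * ‖radialPow κ y‖ ^ (-s)) =ᵐ[volume] fun _ => κ := by
    filter_upwards [compl_mem_ae_iff.2 (measure_singleton (0 : EuclideanSpace ℝ (Fin n)))]
      with y hy
    have hy0 : 0 < ‖y‖ := norm_pos_iff.2 hy
    rw [norm_radialPow (by linarith), ← Real.rpow_mul hy0.le, mul_assoc, ← Real.rpow_add hy0]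
    rw [show (κ - 1) * n + κ * -s = 0 by linarith]; simp
  rw [integral_congr_ae (ae_restrict_of_ae h)]
  simp [mul_comm]

theorem setIntegral_superlevel_norm_rpow_le {n : ℕ} {p a b R : ℝ} (hp : 1 ≤ p) (hpn : p < n)
    (ha : 0 ≤ a) (han : a < n - p) (hb1 : a * n / (n - p) ≤ b) (hb2 : b ≤ a + p)
    {v : EuclideanSpace ℝ (Fin n) → ℝ} (hv : ContDiff ℝ (⊤ : ℕ∞) v) (hc : HasCompactSupport v)
    (hR : 0 < R)
    (hX : ((p - 1) / (n - p - a)) ^ (p - 1) * ∫ x, ‖fderiv ℝ v x‖ ^ p * ‖x‖ ^ (-a) ≤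
      2 * π ^ ((n : ℝ) / 2) / Real.Gamma ((n : ℝ) / 2) * R ^ (n - p - a)) :
    ∫ x in {x | 1 ≤ v x}, ‖x‖ ^ (-b) ≤
      2 * π ^ ((n : ℝ) / 2) / Real.Gamma ((n : ℝ) / 2) * (R ^ (n - b) / (n - b)) := by
  have hn0 : (0 : ℝ) < n := by linarith
  have hn : 0 < n := by exact_mod_cast hn0
  have hnp : 0 < n - p := by linarith
  have hnpa : 0 < n - p - a := by linarith
  obtain ⟨κ, hκdef⟩ : ∃ κ, κ = (n - p) / (n - p - a) := ⟨_, rfl⟩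
  have hκ : 1 ≤ κ := by rw [hκdef, one_le_div hnpa]; linarith
  have hκ0 : 0 < κ := by linarith
  have hκa : κ * (n - p - a) = n - p := by rw [hκdef]; field_simp
  have hL : IsCompact {x | 1 ≤ v x} := isCompact_superlevel hv.continuous hc one_pos
  rw [← setIntegral_closedBall_norm_rpow hn (by linarith) hR.le]
  refine setIntegral_norm_rpow_le_of_le hn hb1 (by linarith) hR hL ?_
  have hs : κ * (a * n / (n - p)) = (κ - 1) * n := by
    field_simp; linear_combination -hκa
  rw [setIntegral_norm_rpow_eq_mul_volume hn hκ hs hL.measurableSet,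
    setIntegral_closedBall_norm_rpow hn (by linarith) hR.le, ← card_mul_volume_ball_eq hn]
  rw [← card_mul_volume_ball_eq hn] at hX
  have h1 := (weighted_volume_superlevel_rpow_le hp hpn han hκ hκa hv hc).trans hX
  have hω : 0 < volume.real (Metric.ball (0 : EuclideanSpace ℝ (Fin n)) 1) :=
    ENNReal.toReal_pos (Metric.measure_ball_pos _ _ one_pos).ne' measure_ball_lt_top.ne
  set ω := volume.real (Metric.ball (0 : EuclideanSpace ℝ (Fin n)) 1)
  set M := volume.real (radialPow κ ⁻¹' {x | 1 ≤ v x})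
  have hM : 0 ≤ M := measureReal_nonneg
  have e : n - a * n / (n - p) = n / κ := by
    field_simp; linear_combination hκa
  have h2 : M ^ ((n - p) / n) ≤ (ω * R ^ (n / κ)) ^ ((n - p) / n) := by
    have h3 : n / κ * ((n - p) / n) = n - p - a := by field_simp; linarith
    have h4 : (ω * R ^ (n / κ)) ^ ((n - p) / n) = ω ^ ((n - p) / n) * R ^ (n - p - a) := by
      rw [Real.mul_rpow hω.le (by positivity), ← Real.rpow_mul hR.le, h3]
    have h5 : ω = ω ^ (p / n) * ω ^ ((n - p) / n) := by
      rw [← Real.rpow_add hω, show p / n + (n - p) / n = 1 by field_simp; ring, Real.rpow_one]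
    have h6 : n * ω ^ (p / n) * M ^ ((n - p) / n) ≤
        n * ω ^ (p / n) * (ω ^ ((n - p) / n) * R ^ (n - p - a)) := by
      refine h1.trans (le_of_eq ?_)
      nth_rewrite 1 [h5]
      ring
    rw [h4]
    exact le_of_mul_le_mul_left h6 (by positivity)
  rw [Real.rpow_le_rpow_iff hM (by positivity) (by positivity)] at h2
  rw [e]
  calc κ * M ≤ κ * (ω * R ^ (n / κ)) := by gcongr
    _ = _ := by field_simp

theorem setIntegral_norm_rpow_rpow_le {n : ℕ} {p a b : ℝ} (hp : 1 ≤ p) (hpn : p < n)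
    (ha : 0 ≤ a) (han : a < n - p) (hb1 : a * n / (n - p) ≤ b) (hb2 : b ≤ a + p)
    {K : Set (EuclideanSpace ℝ (Fin n))} {v : EuclideanSpace ℝ (Fin n) → ℝ}
    (hv : ContDiff ℝ (⊤ : ℕ∞) v) (hc : HasCompactSupport v) (hK : ∀ x ∈ K, 1 ≤ v x) :
    (∫ x in K, ‖x‖ ^ (-b)) ^ ((n - p - a) / (n - b)) ≤
      ((p - 1) / (n - p - a)) ^ (p - 1) *
        (2 * π ^ ((n : ℝ) / 2) / Real.Gamma ((n : ℝ) / 2)) ^ ((b - p - a) / (n - b)) /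
        ((n : ℝ) - b) ^ ((n - p - a) / (n - b)) *
        ∫ x, ‖fderiv ℝ v x‖ ^ p * ‖x‖ ^ (-a) := by
  have hn0 : (0 : ℝ) < n := by linarith
  have hn : 0 < n := by exact_mod_cast hn0
  have hnpa : 0 < n - p - a := by linarith
  have hnb : 0 < n - b := by linarith
  have hp1 : 0 ≤ p - 1 := by linarith
  have hL : IsCompact {x | 1 ≤ v x} := isCompact_superlevel hv.continuous hc one_pos
  have hKL : ∫ x in K, ‖x‖ ^ (-b) ≤ ∫ x in {x | 1 ≤ v x}, ‖x‖ ^ (-b) :=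
    setIntegral_mono_set ((locallyIntegrable_norm_rpow hn (by linarith)).integrableOn_isCompact hL)
      (ae_of_all _ fun x => by positivity) (LE.le.eventuallyLE hK)
  have hμ : 0 ≤ ∫ x in K, ‖x‖ ^ (-b) := integral_nonneg fun x => by positivity
  obtain ⟨S, hS⟩ : ∃ S, S = 2 * π ^ ((n : ℝ) / 2) / Real.Gamma ((n : ℝ) / 2) := ⟨_, rfl⟩
  have hS0 : 0 < S := by
    have := Real.Gamma_pos_of_pos (half_pos hn0)
    rw [hS]; positivity
  have hlvl := fun R => @setIntegral_superlevel_norm_rpow_le n p a b R hp hpn ha han hb1 hb2 v hv hc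
  rw [← hS] at hlvl ⊢
  obtain ⟨X, hXdef⟩ : ∃ X, X = ((p - 1) / (n - p - a)) ^ (p - 1) *
    ∫ x, ‖fderiv ℝ v x‖ ^ p * ‖x‖ ^ (-a) := ⟨_, rfl⟩
  rw [← hXdef] at hlvl
  have hX0 : 0 ≤ X := hXdef ▸ mul_nonneg (by positivity) (integral_nonneg fun x => by positivity)
  obtain ⟨c, hcdef⟩ : ∃ c, c = S ^ ((b - p - a) / (n - b)) / (n - b) ^ ((n - p - a) / (n - b)) :=
    ⟨_, rfl⟩
  have hc0 : 0 < c := by rw [hcdef]; positivity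
  have hgoal : ((p - 1) / (n - p - a)) ^ (p - 1) * S ^ ((b - p - a) / (n - b)) /
        ((n : ℝ) - b) ^ ((n - p - a) / (n - b)) *
        ∫ x, ‖fderiv ℝ v x‖ ^ p * ‖x‖ ^ (-a) = c * X := by
    rw [hcdef, hXdef]; ring
  rw [hgoal, mul_comm, ← div_le_iff₀ hc0]
  refine le_of_forall_pos_le_add fun ε hε => ?_
  rw [div_le_iff₀ hc0]
  have hXS : 0 < (X + ε) / S := by positivity
  have hRR : (((X + ε) / S) ^ (1 / (n - p - a))) ^ (n - p - a) = (X + ε) / S := by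
    rw [← Real.rpow_mul hXS.le, one_div_mul_cancel hnpa.ne', Real.rpow_one]
  have hR0 : 0 < ((X + ε) / S) ^ (1 / (n - p - a)) := by positivity
  set R := ((X + ε) / S) ^ (1 / (n - p - a))
  have h1 := hKL.trans (hlvl R hR0 (by rw [hRR, mul_div_cancel₀ _ hS0.ne']; linarith))
  refine (Real.rpow_le_rpow hμ h1 (by positivity)).trans (le_of_eq ?_)
  rw [Real.mul_rpow hS0.le (by positivity), Real.div_rpow (by positivity) hnb.le,
    ← Real.rpow_mul hR0.le, mul_div_cancel₀ _ hnb.ne', hRR, hcdef,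
    show (n - p - a) / (n - b) = (b - p - a) / (n - b) + 1 by field_simp; ring,
    Real.rpow_add hS0, Real.rpow_one]
  field_simp

theorem capPA_le {n : ℕ} {p a : ℝ} {K : Set (EuclideanSpace ℝ (Fin n))}
    {v : EuclideanSpace ℝ (Fin n) → ℝ} (hv : ContDiff ℝ (⊤ : ℕ∞) v) (hc : HasCompactSupport v)
    (hK : ∀ x ∈ K, 1 ≤ v x) : capPA p a K ≤ ∫ x, ‖fderiv ℝ v x‖ ^ p * ‖x‖ ^ (-a) := by
  refine csInf_le ⟨0, ?_⟩ ⟨v, hv, hc, hK, rfl⟩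
  rintro _ ⟨v, -, -, -, rfl⟩
  exact integral_nonneg fun x => by positivity

theorem le_mul_capPA {n : ℕ} {p a m c : ℝ} {K : Set (EuclideanSpace ℝ (Fin n))}
    (hK : IsCompact K) (hc : 0 < c)
    (h : ∀ v : EuclideanSpace ℝ (Fin n) → ℝ, ContDiff ℝ (⊤ : ℕ∞) v → HasCompactSupport v →
      (∀ x ∈ K, 1 ≤ v x) → m ≤ c * ∫ x, ‖fderiv ℝ v x‖ ^ p * ‖x‖ ^ (-a)) :
    m ≤ c * capPA p a K := by
  rw [mul_comm, ← div_le_iff₀ hc]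
  refine le_csInf ?_ ?_
  · obtain ⟨R, hR0, hR⟩ := hK.isBounded.exists_pos_norm_le
    let φ : ContDiffBump (0 : EuclideanSpace ℝ (Fin n)) := ⟨R, R + 1, hR0, by linarith⟩
    exact ⟨_, φ, φ.contDiff, φ.hasCompactSupport, fun x hx =>
      (φ.one_of_mem_closedBall (by simpa using hR x hx)).ge, rfl⟩
  · rintro _ ⟨v, hv, hvc, hvK, rfl⟩
    rw [div_le_iff₀ hc, mul_comm]
    exact h v hv hvc hvK

theorem capPA_closedBall_mul_rpow_le {n : ℕ} (hn : 0 < n) {p a R R' T : ℝ} (hp : 1 ≤ p)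
    (hR : 0 < R) (hRR' : R < R') (hT : R' ≤ T) {η : ℝ → ℝ} (hη : ContDiff ℝ (⊤ : ℕ∞) η)
    (hη0 : ∀ r, 0 ≤ η r) (hηs : ∀ r, r ∉ Ioo R' T → η r = 0)
    (hA : 0 < ∫ r in R'..T, η r) :
    capPA p a (Metric.closedBall (0 : EuclideanSpace ℝ (Fin n)) R) * (∫ r in R'..T, η r) ^ p ≤
      2 * π ^ ((n : ℝ) / 2) / Real.Gamma ((n : ℝ) / 2) *
        ∫ r in R'..T, r ^ (n - 1) * (η r ^ p * r ^ (-a)) := by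
  have : Nonempty (Fin n) := ⟨⟨0, hn⟩⟩
  have hp0 : 0 < p := by linarith
  obtain ⟨A, hAdef⟩ : ∃ A, A = ∫ r in R'..T, η r := ⟨_, rfl⟩
  rw [← hAdef] at hA ⊢
  have hii : ∀ s t, IntervalIntegrable η volume s t := fun s t =>
    hη.continuous.intervalIntegrable s t
  obtain ⟨g, hg⟩ : ∃ g : ℝ → ℝ, g = fun r => (∫ t in r..T, η t) / A := ⟨_, rfl⟩
  have hgd : ∀ r, HasDerivAt g (-η r / A) r := fun r => by
    rw [hg]
    exact (intervalIntegral.integral_hasDerivAt_left (hii r T)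
      (hη.continuous.stronglyMeasurableAtFilter _ _) hη.continuous.continuousAt).div_const A
  have hgs : ContDiff ℝ (⊤ : ℕ∞) g := by
    refine contDiff_infty_iff_deriv.2 ⟨fun r => (hgd r).differentiableAt, ?_⟩
    rw [show deriv g = fun r => -η r / A from funext fun r => (hgd r).deriv]
    exact hη.neg.div_const A
  have hg1 : ∀ r ≤ R', g r = 1 := fun r hr => by
    have h0 : ∫ t in r..R', η t = 0 := by
      rw [intervalIntegral.integral_congr (g := fun _ => 0), intervalIntegral.integral_zero]
      intro t ht
      rw [uIcc_of_le hr] at ht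
      exact hηs t fun h => (h.1.trans_le ht.2).false
    simp only [hg]
    rw [← intervalIntegral.integral_add_adjacent_intervals (hii r R') (hii R' T), h0, zero_add,
      ← hAdef, div_self hA.ne']
  have hg0 : ∀ r, T ≤ r → g r = 0 := fun r hr => by
    have h0 : ∫ t in r..T, η t = 0 := by
      rw [intervalIntegral.integral_congr (g := fun _ => 0), intervalIntegral.integral_zero]
      intro t ht
      rw [uIcc_of_ge hr] at ht
      exact hηs t fun h => (h.2.trans_le ht.1).false
    simp only [hg, h0, zero_div]
  have hv : ContDiff ℝ (⊤ : ℕ∞) fun x : EuclideanSpace ℝ (Fin n) => g ‖x‖ := by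
    refine contDiff_iff_contDiffAt.2 fun x => ?_
    rcases eq_or_ne x 0 with rfl | hx
    · refine (contDiffAt_const (c := (1 : ℝ))).congr_of_eventuallyEq ?_
      filter_upwards [Metric.ball_mem_nhds (0 : EuclideanSpace ℝ (Fin n)) (hR.trans hRR')]
        with y hy
      exact hg1 _ (by simpa using (mem_ball_zero_iff.1 hy).le)
    · exact hgs.contDiffAt.comp x (contDiffAt_norm ℝ hx)
  have hvc : HasCompactSupport fun x : EuclideanSpace ℝ (Fin n) => g ‖x‖ :=
    HasCompactSupport.intro (isCompact_closedBall 0 T) fun x hx =>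
      hg0 _ (by simpa using le_of_lt (by simpa using hx))
  have hcap := capPA_le (p := p) (a := a) hv hvc
    (K := Metric.closedBall (0 : EuclideanSpace ℝ (Fin n)) R) fun x hx =>
      (hg1 _ ((mem_closedBall_zero_iff.1 hx).trans hRR'.le)).ge
  have hfd : ∀ᵐ x : EuclideanSpace ℝ (Fin n), ‖fderiv ℝ (fun x => g ‖x‖) x‖ ^ p * ‖x‖ ^ (-a) ≤
      (η ‖x‖ / A) ^ p * ‖x‖ ^ (-a) := by
    filter_upwards [compl_mem_ae_iff.2 (measure_singleton (0 : EuclideanSpace ℝ (Fin n)))]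
      with x hx
    have h1 := (hgd ‖x‖).comp_hasFDerivAt x
      ((contDiffAt_norm ℝ hx).differentiableAt one_ne_zero).hasFDerivAt
    have h2 : ‖fderiv ℝ (fun x => g ‖x‖) x‖ ≤ η ‖x‖ / A := by
      rw [show fderiv ℝ (fun x => g ‖x‖) x = _ from h1.fderiv, norm_smul, norm_div, norm_neg,
        Real.norm_of_nonneg (hη0 _), Real.norm_of_nonneg hA.le]
      refine mul_le_of_le_one_right (div_nonneg (hη0 _) hA.le) ?_
      simpa using norm_fderiv_le_of_lipschitz ℝ
        (lipschitzWith_one_norm (E := EuclideanSpace ℝ (Fin n))) (x₀ := x)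
    gcongr
  have hz : ∀ r ∈ Ioi (0 : ℝ) \ Ioc R' T, r ^ (n - 1) • ((η r / A) ^ p * r ^ (-a)) = 0 :=
    fun r hr => by
      rw [hηs r fun h => hr.2 (Ioo_subset_Ioc_self h)]
      simp [hp0.ne']
  have hsub : Ioc R' T ⊆ Ioi (0 : ℝ) := fun r hr => (hR.trans hRR').trans hr.1
  have hint : IntegrableOn (fun r : ℝ => r ^ (n - 1) • ((η r / A) ^ p * r ^ (-a))) (Ioi 0) := by
    refine IntegrableOn.of_forall_sdiff_eq_zero (s := Ioc R' T) ?_ measurableSet_Ioi hz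
    refine IntegrableOn.mono_set (ContinuousOn.integrableOn_Icc ?_) Ioc_subset_Icc_self
    refine (continuous_pow _).continuousOn.smul (ContinuousOn.mul ?_ ?_)
    · exact ((hη.continuous.div_const A).rpow_const fun _ => Or.inr hp0.le).continuousOn
    · exact continuousOn_id.rpow_const fun r hr =>
        Or.inl ((hR.trans hRR').trans_le hr.1).ne'
  have hI : ∫ x : EuclideanSpace ℝ (Fin n), (η ‖x‖ / A) ^ p * ‖x‖ ^ (-a) =
      2 * π ^ ((n : ℝ) / 2) / Real.Gamma ((n : ℝ) / 2) *
        ((∫ r in R'..T, r ^ (n - 1) * (η r ^ p * r ^ (-a))) / A ^ p) := by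
    rw [integral_fun_norm_addHaar volume fun r => (η r / A) ^ p * r ^ (-a),
      ← card_mul_volume_ball_eq hn, finrank_euclideanSpace_fin, nsmul_eq_mul, smul_eq_mul,
      mul_assoc, setIntegral_eq_of_subset_of_forall_sdiff_eq_zero measurableSet_Ioi hsub hz,
      intervalIntegral.integral_of_le hT, ← integral_div]
    congr 3
    ext r
    rw [Real.div_rpow (hη0 r) hA.le, smul_eq_mul]
    ring
  have hint' := (integrable_fun_norm_addHaar
    (volume : Measure (EuclideanSpace ℝ (Fin n))) (f := fun r => (η r / A) ^ p * r ^ (-a))).2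
    (by simpa using hint)
  have hfin := hcap.trans (integral_mono_of_nonneg (ae_of_all _ fun x => by positivity) hint' hfd)
  rw [hI, ← mul_div_assoc, le_div_iff₀ (by positivity)] at hfin
  exact hfin

theorem contDiff_mul_rpow {χ : ℝ → ℝ} (hχ : ContDiff ℝ (⊤ : ℕ∞) χ) {R : ℝ} (hR : 0 < R)
    (h : ∀ r ≤ R, χ r = 0) (c : ℝ) : ContDiff ℝ (⊤ : ℕ∞) fun r => χ r * r ^ c := by
  refine contDiff_iff_contDiffAt.2 fun r => ?_
  rcases lt_or_ge r R with hr | hr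
  · refine (contDiffAt_const (c := (0 : ℝ))).congr_of_eventuallyEq ?_
    filter_upwards [Iio_mem_nhds hr] with t ht
    rw [h t (le_of_lt ht), zero_mul]
  · exact hχ.contDiffAt.mul (contDiffAt_id.rpow_const_of_ne (hR.trans_le hr).ne')

theorem exists_contDiff_cutoff {R R₁ T₁ : ℝ} (hR₁ : R < R₁) (hT₁ : R₁ < T₁) :
    ∃ (R' T : ℝ) (χ : ℝ → ℝ), R < R' ∧ R' < R₁ ∧ T₁ < T ∧ T < T₁ + (R₁ - R) ∧
      ContDiff ℝ (⊤ : ℕ∞) χ ∧ (∀ r, 0 ≤ χ r) ∧ (∀ r, χ r ≤ 1) ∧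
      (∀ r ∈ Icc R₁ T₁, χ r = 1) ∧ ∀ r, r ∉ Ioo R' T → χ r = 0 := by
  let φ : ContDiffBump ((R₁ + T₁) / 2) :=
    ⟨(T₁ - R₁) / 2, (T₁ - R₁) / 2 + (R₁ - R) / 2, by linarith, by linarith⟩
  refine ⟨(R + R₁) / 2, T₁ + (R₁ - R) / 2, φ, by linarith, by linarith, by linarith, by linarith,
    φ.contDiff, fun r => φ.nonneg, fun r => φ.le_one, fun r hr => ?_, fun r hr => ?_⟩
  · refine φ.one_of_mem_closedBall ?_
    rw [Real.closedBall_eq_Icc]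
    change r ∈ Icc ((R₁ + T₁) / 2 - (T₁ - R₁) / 2) ((R₁ + T₁) / 2 + (T₁ - R₁) / 2)
    exact ⟨by linarith [hr.1], by linarith [hr.2]⟩
  · refine Function.notMem_support.1 fun h => hr ?_
    rw [φ.support_eq, Real.ball_eq_Ioo] at h
    have h1 : (R₁ + T₁) / 2 - ((T₁ - R₁) / 2 + (R₁ - R) / 2) < r := h.1
    have h2 : r < (R₁ + T₁) / 2 + ((T₁ - R₁) / 2 + (R₁ - R) / 2) := h.2
    exact ⟨by linarith, by linarith⟩

theorem capPA_one_closedBall_le {n : ℕ} (hn : 0 < n) {a R : ℝ} (ha : a < n - 1) (hR : 0 < R) :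
    capPA 1 a (Metric.closedBall (0 : EuclideanSpace ℝ (Fin n)) R) ≤
      2 * π ^ ((n : ℝ) / 2) / Real.Gamma ((n : ℝ) / 2) * R ^ (n - 1 - a) := by
  have hS : 0 ≤ 2 * π ^ ((n : ℝ) / 2) / Real.Gamma ((n : ℝ) / 2) := by
    rw [← card_mul_volume_ball_eq hn]; positivity
  set S := 2 * π ^ ((n : ℝ) / 2) / Real.Gamma ((n : ℝ) / 2)
  have key : ∀ ε > 0, capPA 1 a (Metric.closedBall (0 : EuclideanSpace ℝ (Fin n)) R) ≤
      S * (R + ε) ^ (n - 1 - a) := fun ε hε => by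
    obtain ⟨R', T, χ, hR', hR₁, hT₁, hT, hχ, hχ0, -, hχ1, hχs⟩ :=
      exists_contDiff_cutoff (R := R) (R₁ := R + ε / 3) (T₁ := R + ε / 2) (by linarith)
        (by linarith)
    have hTle : T ≤ R + ε := by linarith
    have hR'T : R' < T := by linarith
    have hA : 0 < ∫ r in R'..T, χ r := by
      refine intervalIntegral.integral_pos hR'T hχ.continuous.continuousOn (fun r _ => hχ0 r)
        ⟨R + ε / 3, ⟨by linarith, by linarith⟩, ?_⟩
      rw [hχ1 _ ⟨le_rfl, by linarith⟩]
      exact one_pos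
    have h := capPA_closedBall_mul_rpow_le (a := a) hn le_rfl hR hR' hR'T.le hχ hχ0 hχs hA
    rw [Real.rpow_one] at h
    refine le_of_mul_le_mul_right (h.trans ?_) hA
    rw [mul_assoc S, ← intervalIntegral.integral_const_mul ((R + ε) ^ ((n : ℝ) - 1 - a))]
    refine mul_le_mul_of_nonneg_left (intervalIntegral.integral_mono_on hR'T.le ?_ ?_ ?_) hS
    · refine ContinuousOn.intervalIntegrable ?_
      rw [uIcc_of_le hR'T.le]
      refine (continuous_pow _).continuousOn.mul (ContinuousOn.mul ?_ ?_)
      · exact (hχ.continuous.rpow_const fun _ => Or.inr zero_le_one).continuousOn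
      · exact continuousOn_id.rpow_const fun r hr => Or.inl (by simp only [id]; linarith [hr.1])
    · exact (continuous_const.mul hχ.continuous).intervalIntegrable _ _
    · intro r hr
      have hr0 : 0 < r := by linarith [hr.1]
      have e : r ^ (n - 1) * (χ r ^ (1 : ℝ) * r ^ (-a)) = r ^ ((n : ℝ) - 1 - a) * χ r := by
        rw [Real.rpow_one, ← Real.rpow_natCast, sub_eq_add_neg _ a, Real.rpow_add hr0,
          Nat.cast_sub hn]
        push_cast; ring
      rw [e]
      exact mul_le_mul_of_nonneg_right
        (Real.rpow_le_rpow hr0.le (hr.2.trans hTle) (by linarith)) (hχ0 r)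
  have hlim : Tendsto (fun ε : ℝ => S * (R + ε) ^ (n - 1 - a)) (𝓝[>] 0)
      (𝓝 (S * R ^ (n - 1 - a))) := by
    have : ContinuousAt (fun ε : ℝ => S * (R + ε) ^ (n - 1 - a)) 0 :=
      continuousAt_const.mul ((continuousAt_const.add continuousAt_id).rpow_const
        (Or.inl (by simpa using hR.ne')))
    simpa using this.tendsto.mono_left nhdsWithin_le_nhds
  exact ge_of_tendsto hlim (eventually_nhdsWithin_of_forall key)

theorem capPA_closedBall_le_mul_rpow {n : ℕ} (hn : 0 < n) {p a γ R R₁ T₁ : ℝ} (hp : 1 < p)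
    (hγ : γ * (p - 1) = n - 1 - a) (hR : 0 < R) (hR₁ : R < R₁) (hT₁ : R₁ < T₁) :
    capPA p a (Metric.closedBall (0 : EuclideanSpace ℝ (Fin n)) R) ≤
      2 * π ^ ((n : ℝ) / 2) / Real.Gamma ((n : ℝ) / 2) *
        (∫ r in R₁..T₁, r ^ (-γ)) ^ (1 - p) := by
  have hS : 0 ≤ 2 * π ^ ((n : ℝ) / 2) / Real.Gamma ((n : ℝ) / 2) := by
    rw [← card_mul_volume_ball_eq hn]; positivity
  set S := 2 * π ^ ((n : ℝ) / 2) / Real.Gamma ((n : ℝ) / 2)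
  obtain ⟨R', T, χ, hR', hR'₁, hT₁T, hT, hχ, hχ0, hχle, hχ1, hχs⟩ := exists_contDiff_cutoff hR₁ hT₁
  have hR'0 : 0 < R' := by linarith
  have hR'T : R' < T := by linarith
  have hη := contDiff_mul_rpow hχ hR'0 (fun r hr => hχs r fun h => (h.1.trans_le hr).false) (-γ)
  have hη0 : ∀ r, 0 ≤ χ r * r ^ (-γ) := fun r => by
    by_cases hr : r ∈ Ioo R' T
    · have : 0 < r := hR'0.trans hr.1
      exact mul_nonneg (hχ0 r) (by positivity)
    · simp [hχs r hr]
  have hJ₁ : 0 < ∫ r in R₁..T₁, r ^ (-γ) := by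
    refine intervalIntegral.intervalIntegral_pos_of_pos_on ?_ (fun r hr => ?_) hT₁
    · exact intervalIntegral.intervalIntegrable_rpow (Or.inr fun h => by
        rw [uIcc_of_le hT₁.le] at h; linarith [h.1])
    · have : 0 < r := by linarith [hr.1]
      positivity
  have hJ : ∫ r in R₁..T₁, r ^ (-γ) ≤ ∫ r in R'..T, χ r * r ^ (-γ) := by
    have e : ∫ r in R₁..T₁, r ^ (-γ) = ∫ r in R₁..T₁, χ r * r ^ (-γ) := by
      refine intervalIntegral.integral_congr fun r hr => ?_
      rw [uIcc_of_le hT₁.le] at hr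
      simp only [hχ1 r hr, one_mul]
    rw [e]
    exact intervalIntegral.integral_mono_interval hR'₁.le hT₁.le hT₁T.le
      (ae_of_all _ hη0) (hη.continuous.intervalIntegrable _ _)
  have hJ0 := hJ₁.trans_le hJ
  have h := capPA_closedBall_mul_rpow_le (a := a) hn hp.le hR hR' hR'T.le hη hη0
    (fun r hr => by rw [hχs r hr, zero_mul]) hJ0
  have hE : ∫ r in R'..T, r ^ (n - 1) * ((χ r * r ^ (-γ)) ^ p * r ^ (-a)) ≤
      ∫ r in R'..T, χ r * r ^ (-γ) := by
    refine intervalIntegral.integral_mono_on hR'T.le ?_ (hη.continuous.intervalIntegrable _ _) ?_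
    · refine ContinuousOn.intervalIntegrable ?_
      rw [uIcc_of_le hR'T.le]
      refine (continuous_pow _).continuousOn.mul (ContinuousOn.mul ?_ ?_)
      · exact (hη.continuous.rpow_const fun _ => Or.inr (by linarith)).continuousOn
      · exact continuousOn_id.rpow_const fun r hr => Or.inl (by simp only [id]; linarith [hr.1])
    · intro r hr
      have hr0 : 0 < r := by linarith [hr.1]
      have e : r ^ (n - 1) * ((χ r * r ^ (-γ)) ^ p * r ^ (-a)) = χ r ^ p * r ^ (-γ) := by
        rw [Real.mul_rpow (hχ0 r) (by positivity), ← Real.rpow_mul hr0.le, ← Real.rpow_natCast,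
          Nat.cast_sub hn]
        rw [show -γ = ((n : ℝ) - (1 : ℕ)) + (-γ * p + -a) by push_cast; linear_combination hγ,
          Real.rpow_add hr0, Real.rpow_add hr0]
        rw [show ((n : ℝ) - (1 : ℕ)) + (-γ * p + -a) = -γ by push_cast; linear_combination -hγ]
        ring
      rw [e]
      refine mul_le_mul_of_nonneg_right ?_ (by positivity)
      exact Real.rpow_le_self_of_le_one (hχ0 r) (hχle r) hp.le
  set J := ∫ r in R'..T, χ r * r ^ (-γ)
  calc _ ≤ S * J / J ^ p := by
        rw [le_div_iff₀ (by positivity)]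
        exact h.trans (mul_le_mul_of_nonneg_left hE hS)
    _ = S * J ^ (1 - p) := by rw [Real.rpow_sub hJ0, Real.rpow_one, mul_div_assoc]
    _ ≤ _ := mul_le_mul_of_nonneg_left
        (Real.rpow_le_rpow_of_nonpos hJ₁ hJ (by linarith)) hS

theorem mul_capPA_closedBall_le {n : ℕ} {p a R : ℝ} (hp : 1 ≤ p) (hpn : p < n)
    (han : a < n - p) (hR : 0 < R) :
    ((p - 1) / (n - p - a)) ^ (p - 1) *
      capPA p a (Metric.closedBall (0 : EuclideanSpace ℝ (Fin n)) R) ≤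
      2 * π ^ ((n : ℝ) / 2) / Real.Gamma ((n : ℝ) / 2) * R ^ (n - p - a) := by
  have hn : 0 < n := by
    have : (0 : ℝ) < n := by linarith
    exact_mod_cast this
  rcases hp.eq_or_lt with rfl | hp
  · simpa using capPA_one_closedBall_le hn han hR
  have hp1 : 0 < p - 1 := by linarith
  have hnpa : 0 < n - p - a := by linarith
  obtain ⟨γ, hγdef⟩ : ∃ γ, γ = (n - 1 - a) / (p - 1) := ⟨_, rfl⟩
  have hγ : γ * (p - 1) = n - 1 - a := by rw [hγdef]; field_simp
  have hγ1 : γ - 1 = (n - p - a) / (p - 1) := by rw [hγdef]; field_simp; ring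
  have hγ0 : 0 < γ - 1 := by rw [hγ1]; positivity
  have hJ : Tendsto (fun k : ℕ => ∫ r in (R + 1 / ((k : ℝ) + 1))..(R + ((k : ℝ) + 2)), r ^ (-γ))
      atTop (𝓝 (R ^ (1 - γ) / (γ - 1))) := by
    have e : ∀ k : ℕ, ∫ r in (R + 1 / ((k : ℝ) + 1))..(R + ((k : ℝ) + 2)), r ^ (-γ) =
        ((R + 1 / ((k : ℝ) + 1)) ^ (1 - γ) - (R + ((k : ℝ) + 2)) ^ (-(γ - 1))) / (γ - 1) :=
      fun k => by
        have h1 : R < R + 1 / ((k : ℝ) + 1) := by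
          have : 0 < 1 / ((k : ℝ) + 1) := by positivity
          linarith
        have h2 : R < R + ((k : ℝ) + 2) := by
          have : 0 < (k : ℝ) + 2 := by positivity
          linarith
        rw [integral_rpow (Or.inr ⟨by linarith, fun h => by
          have := (lt_min h1 h2).trans_le h.1
          linarith⟩), show -γ + 1 = 1 - γ by ring, show 1 - γ = -(γ - 1) by ring, div_neg,
          ← neg_div, neg_sub]
    simp_rw [e]
    rw [show R ^ (1 - γ) / (γ - 1) = ((R + 0) ^ (1 - γ) - 0) / (γ - 1) by simp]
    refine (Tendsto.sub ?_ ?_).div_const _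
    · exact (tendsto_const_nhds.add tendsto_one_div_add_atTop_nhds_zero_nat).rpow_const
        (Or.inl (by simpa using hR.ne'))
    · exact (tendsto_rpow_neg_atTop hγ0).comp (tendsto_atTop_add_const_left _ _
        (tendsto_atTop_add_const_right _ _ tendsto_natCast_atTop_atTop))
  have hR1 : 0 < R ^ (1 - γ) / (γ - 1) := by positivity
  have hlim := ((hJ.rpow_const (p := 1 - p) (Or.inl hR1.ne')).const_mul
    (2 * π ^ ((n : ℝ) / 2) / Real.Gamma ((n : ℝ) / 2)))
  have hcap := ge_of_tendsto' hlim fun k => capPA_closedBall_le_mul_rpow (n := n) hn hp hγ hR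
    (R₁ := R + 1 / ((k : ℝ) + 1)) (T₁ := R + ((k : ℝ) + 2))
    (by
      have : 0 < 1 / ((k : ℝ) + 1) := by positivity
      linarith)
    (by
      have h1 : 1 / ((k : ℝ) + 1) ≤ 1 := by
        rw [div_le_one (by positivity)]
        linarith [(Nat.cast_nonneg k : (0 : ℝ) ≤ k)]
      linarith [(Nat.cast_nonneg k : (0 : ℝ) ≤ k)])
  have hval : (R ^ (1 - γ) / (γ - 1)) ^ (1 - p) =
      R ^ (n - p - a) * ((n - p - a) / (p - 1)) ^ (p - 1) := by
    rw [Real.div_rpow (by positivity) hγ0.le, ← Real.rpow_mul hR.le,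
      show (1 - γ) * (1 - p) = n - p - a by linear_combination hγ,
      show 1 - p = -(p - 1) by ring, Real.rpow_neg hγ0.le, div_inv_eq_mul, hγ1]
  rw [hval] at hcap
  refine (mul_le_mul_of_nonneg_left hcap (by positivity)).trans (le_of_eq ?_)
  have h1 : ((p - 1) / (n - p - a)) ^ (p - 1) * ((n - p - a) / (p - 1)) ^ (p - 1) = 1 := by
    rw [← Real.mul_rpow (by positivity) (by positivity), div_mul_div_cancel₀ hnpa.ne',
      div_self hp1.ne', Real.one_rpow]
  linear_combination (2 * π ^ ((n : ℝ) / 2) / Real.Gamma ((n : ℝ) / 2) * R ^ (n - p - a)) * h1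

end

/-- The isocapacitary inequality
`μ_b(K)^{(n−p−a)/(n−b)} ≤ ((p−1)/(n−p−a))^{p−1} |S^{n−1}|^{(b−p−a)/(n−b)}
   (n−b)^{−(n−p−a)/(n−b)} cap_{p,a}(K)`,
with equality for every closed ball centered at the origin. -/
theorem isocapacitary_inequality
    (n : ℕ) (p a b : ℝ) (hp : 1 ≤ p) (hpn : p < n)
    (ha : 0 ≤ a) (han : a < n - p) (hb1 : a * n / (n - p) ≤ b) (hb2 : b ≤ a + p) :
    (∀ K : Set (EuclideanSpace ℝ (Fin n)), IsCompact K →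
      (∫ x in K, ‖x‖ ^ (-b)) ^ ((n - p - a) / (n - b)) ≤
        ((p - 1) / (n - p - a)) ^ (p - 1) *
          (2 * π ^ ((n : ℝ) / 2) / Real.Gamma ((n : ℝ) / 2)) ^ ((b - p - a) / (n - b)) /
          ((n : ℝ) - b) ^ ((n - p - a) / (n - b)) *
          capPA p a K) ∧
    (∀ R : ℝ, 0 < R →
      (∫ x in Metric.closedBall (0 : EuclideanSpace ℝ (Fin n)) R,
          ‖x‖ ^ (-b)) ^ ((n - p - a) / (n - b)) =
        ((p - 1) / (n - p - a)) ^ (p - 1) *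
          (2 * π ^ ((n : ℝ) / 2) / Real.Gamma ((n : ℝ) / 2)) ^ ((b - p - a) / (n - b)) /
          ((n : ℝ) - b) ^ ((n - p - a) / (n - b)) *
          capPA p a (Metric.closedBall (0 : EuclideanSpace ℝ (Fin n)) R)) := by
  have hn0 : (0 : ℝ) < n := by linarith
  have hn : 0 < n := by exact_mod_cast hn0
  have hnpa : 0 < n - p - a := by linarith
  have hnb : 0 < n - b := by linarith
  have hS0 : 0 < 2 * π ^ ((n : ℝ) / 2) / Real.Gamma ((n : ℝ) / 2) := by
    have := Real.Gamma_pos_of_pos (half_pos hn0)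
    positivity
  have hC : 0 < ((p - 1) / (n - p - a)) ^ (p - 1) := by
    rcases hp.eq_or_lt with rfl | hp
    · simp
    · have : 0 < p - 1 := by linarith
      positivity
  have hmain : ∀ K : Set (EuclideanSpace ℝ (Fin n)), IsCompact K →
      (∫ x in K, ‖x‖ ^ (-b)) ^ ((n - p - a) / (n - b)) ≤
        ((p - 1) / (n - p - a)) ^ (p - 1) *
          (2 * π ^ ((n : ℝ) / 2) / Real.Gamma ((n : ℝ) / 2)) ^ ((b - p - a) / (n - b)) /
          ((n : ℝ) - b) ^ ((n - p - a) / (n - b)) *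
          capPA p a K := fun K hK =>
    le_mul_capPA hK (by positivity) fun v hv hc hvK =>
      setIntegral_norm_rpow_rpow_le hp hpn ha han hb1 hb2 hv hc hvK
  refine ⟨hmain, fun R hR => le_antisymm (hmain _ (isCompact_closedBall _ _)) ?_⟩
  have hcap := mul_capPA_closedBall_le hp hpn han hR
  rw [setIntegral_closedBall_norm_rpow hn (by linarith) hR.le]
  set S := 2 * π ^ ((n : ℝ) / 2) / Real.Gamma ((n : ℝ) / 2)
  calc _ = S ^ ((b - p - a) / (n - b)) / (n - b) ^ ((n - p - a) / (n - b)) *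
        (((p - 1) / (n - p - a)) ^ (p - 1) *
          capPA p a (Metric.closedBall (0 : EuclideanSpace ℝ (Fin n)) R)) := by ring
    _ ≤ S ^ ((b - p - a) / (n - b)) / (n - b) ^ ((n - p - a) / (n - b)) *
        (S * R ^ (n - p - a)) := mul_le_mul_of_nonneg_left hcap (by positivity)
    _ = _ := by
      rw [Real.mul_rpow hS0.le (by positivity), Real.div_rpow (by positivity) hnb.le,
        ← Real.rpow_mul hR.le, mul_div_cancel₀ _ hnb.ne',
        show (n - p - a) / (n - b) = (b - p - a) / (n - b) + 1 by field_simp; ring,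
        Real.rpow_add hS0, Real.rpow_one]
      ring
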